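/- Let λ > 0, a ∈ ℝ, K > 0, T > 0, and fix a smooth solution ū of ∂_t ū + a ∂_x ū = λ² ∂_{xx} ū with v̄ = a ū − λ² ∂_x ū satisfying ∫₀^T ∫_ℝ |∂_t v̄|² dx ds ≤ K. For each ε in an interval (0, ε₀), let (u^ε, v^ε) be a strong solution of the Jin–Xin system with parameter ε satisfying the hypotheses of the continuous stability theorem (vanishing relative entropy flux at x = ±∞, integrability of the relevant integrands, φ^ε(0) < ∞), and let φ^ε(t) = ∫_ℝ E(w^ε|w̄)(x,t) dx. If φ^ε(0) → 0 as ε → 0, then sup_{t ∈ [0,T)} φ^ε(t) → 0 as ε → 0. -/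

import Mathlib

open MeasureTheory Filter Topology

/- Relative entropy E(w|w̄) for the Jin–Xin system. -/
noncomputable def relEntropy (ε lam a : ℝ) (u v ub vb : ℝ → ℝ → ℝ) (x t : ℝ) : ℝ :=
  lam ^ 2 / 2 * (u x t - ub x t) ^ 2 + ε ^ 2 / 2 * (v x t - vb x t) ^ 2
    - ε ^ 2 * a * (u x t - ub x t) * (v x t - vb x t)

/- Relative entropy flux F(w|w̄) for the Jin–Xin system. -/
noncomputable def relEntropyFlux (ε lam a : ℝ) (u v ub vb : ℝ → ℝ → ℝ) (x t : ℝ) : ℝ :=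
  -(lam ^ 2 * a / 2) * (u x t - ub x t) ^ 2 - ε ^ 2 * a / 2 * (v x t - vb x t) ^ 2
    + lam ^ 2 * (u x t - ub x t) * (v x t - vb x t)


open MeasureTheory Filter Topology
set_option linter.unusedVariables false

/-- joint continuity -/
abbrev Cn (f : ℝ → ℝ → ℝ) : Prop := Continuous (fun p : ℝ × ℝ => f p.1 p.2)

/-- `f` is `C¹` with partial derivatives `fx`, `ft` -/
structure C1 (f fx ft : ℝ → ℝ → ℝ) : Prop where
  c : Cn f
  cx : Cn fx
  ct : Cn ft
  hx : ∀ x t, HasDerivAt (fun y => f y t) (fx x t) x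
  ht : ∀ x t, HasDerivAt (fun τ => f x τ) (ft x t) t

noncomputable def Av (α β : ℝ) (f : ℝ → ℝ → ℝ) : ℝ → ℝ → ℝ :=
  fun x t => ∫ s in (0:ℝ)..1, f (x + α * s) (t + β * s)

lemma hasDerivAt_param (g gx : ℝ → ℝ → ℝ) (hg : Cn g) (hgx : Cn gx)
    (h : ∀ x s, HasDerivAt (fun y => g y s) (gx x s) x) (a b x : ℝ) :
    HasDerivAt (fun y => ∫ s in a..b, g y s) (∫ s in a..b, gx x s) x := by
  have hK : IsCompact ((Metric.closedBall x 1) ×ˢ (Set.uIcc a b)) :=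
    (isCompact_closedBall x 1).prod isCompact_uIcc
  obtain ⟨C, hC⟩ := hK.exists_bound_of_continuousOn (f := fun p : ℝ × ℝ => gx p.1 p.2)
    hgx.continuousOn
  have hsl : ∀ y, Continuous (g y) := fun y => hg.comp (by fun_prop : Continuous (fun s => (y, s)))
  have hslx : ∀ y, Continuous (gx y) :=
    fun y => hgx.comp (by fun_prop : Continuous (fun s => (y, s)))
  refine (intervalIntegral.hasDerivAt_integral_of_dominated_loc_of_deriv_le
    (F := g) (F' := gx) (s := Metric.closedBall x 1) (bound := fun _ => C)
    (Metric.closedBall_mem_nhds x one_pos) ?_ ?_ ?_ ?_ ?_ ?_).2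
  · exact Eventually.of_forall fun y => (hsl y).aestronglyMeasurable
  · exact (hsl x).intervalIntegrable _ _
  · exact (hslx x).aestronglyMeasurable
  · refine Eventually.of_forall fun s hs y hy => hC (y, s) ⟨hy, Set.uIoc_subset_uIcc hs⟩
  · exact intervalIntegrable_const
  · exact Eventually.of_forall fun s _ y _ => h y s

lemma Cn.sh {f : ℝ → ℝ → ℝ} (hf : Cn f) (α β : ℝ) : Cn (fun x t => f (x + α) (t + β)) :=
  hf.comp (by fun_prop : Continuous (fun p : ℝ × ℝ => (p.1 + α, p.2 + β)))

lemma Cn.slx {f : ℝ → ℝ → ℝ} (hf : Cn f) (t : ℝ) : Continuous (fun x => f x t) :=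
  hf.comp (by fun_prop : Continuous (fun x : ℝ => (x, t)))

lemma Cn.slt {f : ℝ → ℝ → ℝ} (hf : Cn f) (x : ℝ) : Continuous (fun t => f x t) :=
  hf.comp (by fun_prop : Continuous (fun t : ℝ => (x, t)))

lemma Cn.line {f : ℝ → ℝ → ℝ} (hf : Cn f) (α β x t : ℝ) :
    Continuous (fun s => f (x + α * s) (t + β * s)) :=
  hf.comp (by fun_prop : Continuous (fun s : ℝ => (x + α * s, t + β * s)))

lemma Cn.av {f : ℝ → ℝ → ℝ} (hf : Cn f) (α β : ℝ) : Cn (Av α β f) := by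
  refine intervalIntegral.continuous_parametric_intervalIntegral_of_continuous'
    (f := fun (p : ℝ × ℝ) s => f (p.1 + α * s) (p.2 + β * s)) ?_ 0 1
  exact hf.comp (by fun_prop : Continuous (fun q : (ℝ × ℝ) × ℝ =>
    (q.1.1 + α * q.2, q.1.2 + β * q.2)))

lemma Av_derivx {f fx : ℝ → ℝ → ℝ} (hf : Cn f) (hfx : Cn fx)
    (h : ∀ x t, HasDerivAt (fun y => f y t) (fx x t) x) (α β x t : ℝ) :
    HasDerivAt (fun y => Av α β f y t) (Av α β fx x t) x := by
  refine hasDerivAt_param (fun y s => f (y + α * s) (t + β * s))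
    (fun y s => fx (y + α * s) (t + β * s)) ?_ ?_ ?_ 0 1 x
  · exact hf.comp (by fun_prop : Continuous (fun q : ℝ × ℝ => (q.1 + α * q.2, t + β * q.2)))
  · exact hfx.comp (by fun_prop : Continuous (fun q : ℝ × ℝ => (q.1 + α * q.2, t + β * q.2)))
  · intro y s
    exact (h (y + α * s) (t + β * s)).comp_add_const y (α * s)

lemma Av_derivt {f ft : ℝ → ℝ → ℝ} (hf : Cn f) (hft : Cn ft)
    (h : ∀ x t, HasDerivAt (fun y => f x y) (ft x t) t) (α β x t : ℝ) :
    HasDerivAt (fun y => Av α β f x y) (Av α β ft x t) t := by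
  refine hasDerivAt_param (fun y s => f (x + α * s) (y + β * s))
    (fun y s => ft (x + α * s) (y + β * s)) ?_ ?_ ?_ 0 1 t
  · exact hf.comp (by fun_prop : Continuous (fun q : ℝ × ℝ => (x + α * q.2, q.1 + β * q.2)))
  · exact hft.comp (by fun_prop : Continuous (fun q : ℝ × ℝ => (x + α * q.2, q.1 + β * q.2)))
  · intro y s
    exact (h (x + α * s) (y + β * s)).comp_add_const y (β * s)

lemma C1.av {f fx ft : ℝ → ℝ → ℝ} (h : C1 f fx ft) (α β : ℝ) :
    C1 (Av α β f) (Av α β fx) (Av α β ft) :=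
  ⟨h.c.av α β, h.cx.av α β, h.ct.av α β, Av_derivx h.c h.cx h.hx α β, Av_derivt h.c h.ct h.ht α β⟩

lemma C1.sh {f fx ft : ℝ → ℝ → ℝ} (h : C1 f fx ft) (α β : ℝ) :
    C1 (fun x t => f (x + α) (t + β)) (fun x t => fx (x + α) (t + β))
      (fun x t => ft (x + α) (t + β)) :=
  ⟨h.c.sh α β, h.cx.sh α β, h.ct.sh α β, fun x t => (h.hx _ _).comp_add_const x α,
    fun x t => (h.ht _ _).comp_add_const t β⟩

lemma C1.add {f fx ft g gx gt : ℝ → ℝ → ℝ} (h : C1 f fx ft) (h' : C1 g gx gt) :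
    C1 (fun x t => f x t + g x t) (fun x t => fx x t + gx x t) (fun x t => ft x t + gt x t) :=
  ⟨h.c.add h'.c, h.cx.add h'.cx, h.ct.add h'.ct, fun x t => (h.hx _ _).add (h'.hx _ _),
    fun x t => (h.ht _ _).add (h'.ht _ _)⟩

lemma C1.sub {f fx ft g gx gt : ℝ → ℝ → ℝ} (h : C1 f fx ft) (h' : C1 g gx gt) :
    C1 (fun x t => f x t - g x t) (fun x t => fx x t - gx x t) (fun x t => ft x t - gt x t) :=
  ⟨h.c.sub h'.c, h.cx.sub h'.cx, h.ct.sub h'.ct, fun x t => (h.hx _ _).sub (h'.hx _ _),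
    fun x t => (h.ht _ _).sub (h'.ht _ _)⟩

lemma C1.smul {f fx ft : ℝ → ℝ → ℝ} (h : C1 f fx ft) (c : ℝ) :
    C1 (fun x t => c * f x t) (fun x t => c * fx x t) (fun x t => c * ft x t) :=
  ⟨continuous_const.mul h.c, continuous_const.mul h.cx, continuous_const.mul h.ct,
    fun x t => (h.hx _ _).const_mul c, fun x t => (h.ht _ _).const_mul c⟩

/-- averaging a derivative in `x` -/
lemma Av_fx {f fx : ℝ → ℝ → ℝ} (hfx : Cn fx)
    (h : ∀ x t, HasDerivAt (fun y => f y t) (fx x t) x) {α : ℝ} (hα : α ≠ 0) (x t : ℝ) :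
    Av α 0 fx x t = (f (x + α) t - f x t) / α := by
  have h1 : ∫ s in (0:ℝ)..1, α * fx (x + α * s) t = f (x + α * 1) t - f (x + α * 0) t := by
    refine intervalIntegral.integral_eq_sub_of_hasDerivAt (f := fun s => f (x + α * s) t) ?_ ?_
    · intro s _
      have h2 : HasDerivAt (fun s : ℝ => x + α * s) α s := by
        simpa using ((hasDerivAt_id s).const_mul α).const_add x
      have := (h (x + α * s) t).comp s h2
      simpa [mul_comm, Function.comp_def] using this
    · have := (hfx.line α 0 x t)
      simp only [zero_mul, add_zero] at this
      exact (continuous_const.mul this).intervalIntegrable _ _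
  rw [intervalIntegral.integral_const_mul] at h1
  simp only [Av, zero_mul, add_zero]
  rw [eq_div_iff hα, mul_comm, h1]; simp

/-- averaging a derivative in `t` -/
lemma Av_ft {f ft : ℝ → ℝ → ℝ} (hft : Cn ft) 
    (h : ∀ x t, HasDerivAt (fun y => f x y) (ft x t) t) (β : ℝ) (x t : ℝ) :
    β * Av 0 β ft x t = f x (t + β) - f x t := by
  have h1 : ∫ s in (0:ℝ)..1, β * ft x (t + β * s) = f x (t + β * 1) - f x (t + β * 0) := by
    refine intervalIntegral.integral_eq_sub_of_hasDerivAt (f := fun s => f x (t + β * s)) ?_ ?_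
    · intro s _
      have h2 : HasDerivAt (fun s : ℝ => t + β * s) β s := by
        simpa using ((hasDerivAt_id s).const_mul β).const_add t
      have := (h x (t + β * s)).comp s h2
      simpa [mul_comm, Function.comp_def] using this
    · have := (hft.line 0 β x t)
      simp only [zero_mul, add_zero] at this
      exact (continuous_const.mul this).intervalIntegrable _ _
  rw [intervalIntegral.integral_const_mul] at h1
  simp only [Av, zero_mul, add_zero]
  rw [h1]; simp

lemma sq_int_le (f : ℝ → ℝ) (hf : Continuous f) :
    (∫ s in (0:ℝ)..1, f s) ^ 2 ≤ ∫ s in (0:ℝ)..1, f s ^ 2 := by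
  set c := ∫ s in (0:ℝ)..1, f s with hc
  have h0 : 0 ≤ ∫ s in (0:ℝ)..1, (f s - c) ^ 2 :=
    intervalIntegral.integral_nonneg zero_le_one fun s _ => sq_nonneg _
  have h1 : ∫ s in (0:ℝ)..1, (f s - c) ^ 2 = (∫ s in (0:ℝ)..1, f s ^ 2) - c ^ 2 := by
    have : ∀ s, (f s - c) ^ 2 = (f s ^ 2 - 2 * c * f s) + c ^ 2 := fun s => by ring
    simp only [this]
    rw [intervalIntegral.integral_add, intervalIntegral.integral_sub,
      intervalIntegral.integral_const_mul, ← hc]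
    · simp; ring
    all_goals exact Continuous.intervalIntegrable (by fun_prop) _ _
  linarith

lemma Av_sq_le {f : ℝ → ℝ → ℝ} (hf : Cn f) (α β x t : ℝ) :
    (Av α β f x t) ^ 2 ≤ Av α β (fun x t => f x t ^ 2) x t :=
  sq_int_le _ (hf.line α β x t)

lemma Cn.sq {f : ℝ → ℝ → ℝ} (hf : Cn f) : Cn (fun x t => f x t ^ 2) := hf.pow 2

/-- slices of an average -/
lemma Av_int {g : ℝ → ℝ → ℝ} (hg : Cn g) (hpos : ∀ x t, 0 ≤ g x t) (α β t M : ℝ)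
    (h : ∀ s ∈ Set.Icc (0:ℝ) 1, Integrable (fun x => g x (t + β * s)) ∧
      ∫ x, g x (t + β * s) ≤ M) :
    Integrable (fun x => Av α β g x t) ∧ ∫ x, Av α β g x t ≤ M := by
  have hc : Continuous (fun p : ℝ × ℝ => g (p.1 + α * p.2) (t + β * p.2)) :=
    hg.comp (by fun_prop : Continuous (fun q : ℝ × ℝ => (q.1 + α * q.2, t + β * q.2)))
  have hsl : ∀ s ∈ Set.Icc (0:ℝ) 1, Integrable (fun x => g (x + α * s) (t + β * s)) ∧
      ∫ x, g (x + α * s) (t + β * s) ≤ M := by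
    intro s hs
    refine ⟨(h s hs).1.comp_add_right (α * s), ?_⟩
    rw [integral_add_right_eq_self (fun x => g x (t + β * s))]
    exact (h s hs).2
  have hM : 0 ≤ M := le_trans (integral_nonneg fun x => hpos _ _) (hsl 0 (by simp)).2
  have hI : Integrable (fun p : ℝ × ℝ => g (p.1 + α * p.2) (t + β * p.2))
      ((volume : Measure ℝ).prod (volume.restrict (Set.Ioc (0:ℝ) 1))) := by
    rw [integrable_prod_iff' hc.aestronglyMeasurable]
    constructor
    · filter_upwards [ae_restrict_mem measurableSet_Ioc] with s hs
      exact (hsl s (Set.Ioc_subset_Icc_self hs)).1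
    · refine Integrable.mono' (g := fun _ => M) (integrable_const _) ?_ ?_
      · exact (hc.norm.stronglyMeasurable.integral_prod_left').aestronglyMeasurable
      · filter_upwards [ae_restrict_mem measurableSet_Ioc] with s hs
        simp only [Real.norm_of_nonneg (hpos _ _)]
        rw [Real.norm_of_nonneg (integral_nonneg fun x => hpos _ _)]
        exact (hsl s (Set.Ioc_subset_Icc_self hs)).2
  have hAv : ∀ x, Av α β g x t = ∫ s in Set.Ioc (0:ℝ) 1, g (x + α * s) (t + β * s) := fun x => by
    simp only [Av]; rw [intervalIntegral.integral_of_le zero_le_one]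
  simp only [hAv]
  refine ⟨hI.integral_prod_left, ?_⟩
  rw [← integral_prod _ hI, integral_prod_symm _ hI]
  calc _ ≤ ∫ s in Set.Ioc (0:ℝ) 1, M := by
        refine setIntegral_mono_on hI.integral_prod_right (integrable_const _)
          measurableSet_Ioc ?_
        intro s hs
        exact (hsl s (Set.Ioc_subset_Icc_self hs)).2
    _ = M := by simp

/-- uniform `L²` bound on slices -/
def L2 (f : ℝ → ℝ → ℝ) (I : Set ℝ) (M : ℝ) : Prop :=
  ∀ t ∈ I, Integrable (fun x => f x t ^ 2) ∧ ∫ x, f x t ^ 2 ≤ M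

lemma L2_of_le {f g : ℝ → ℝ → ℝ} {I : Set ℝ} {M : ℝ} (hf : Cn f)
    (h : ∀ t ∈ I, Integrable (fun x => g x t) ∧ ∫ x, g x t ≤ M)
    (hle : ∀ x, ∀ t ∈ I, f x t ^ 2 ≤ g x t) : L2 f I M := by
  intro t ht
  have hi : Integrable (fun x => f x t ^ 2) :=
    (h t ht).1.mono' ((hf.sq.slx t).aestronglyMeasurable) (Eventually.of_forall fun x => by
      rw [Real.norm_of_nonneg (sq_nonneg _)]; exact hle x t ht)
  exact ⟨hi, (integral_mono hi (h t ht).1 fun x => hle x t ht).trans (h t ht).2⟩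

lemma L2.av {f : ℝ → ℝ → ℝ} {I J : Set ℝ} {M : ℝ} (hf : Cn f) (h : L2 f I M) (α β : ℝ)
    (hJ : ∀ t ∈ J, ∀ s ∈ Set.Icc (0:ℝ) 1, t + β * s ∈ I) : L2 (Av α β f) J M := by
  refine L2_of_le (g := Av α β (fun x t => f x t ^ 2)) (hf.av α β) ?_ ?_
  · intro t ht
    exact Av_int hf.sq (fun x t => sq_nonneg _) α β t M fun s hs => h _ (hJ t ht s hs)
  · intro x t _
    exact Av_sq_le hf α β x t

lemma L2.avx {f : ℝ → ℝ → ℝ} {I : Set ℝ} {M : ℝ} (hf : Cn f) (h : L2 f I M) (α : ℝ) :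
    L2 (Av α 0 f) I M := h.av hf α 0 (fun t ht s _ => by simpa using ht)

lemma L2.sh {f : ℝ → ℝ → ℝ} {I J : Set ℝ} {M : ℝ} (h : L2 f I M) (α β : ℝ)
    (hJ : ∀ t ∈ J, t + β ∈ I) : L2 (fun x t => f (x + α) (t + β)) J M := by
  intro t ht
  have := h _ (hJ t ht)
  refine ⟨this.1.comp_add_right α, ?_⟩
  rw [integral_add_right_eq_self (fun x => f x (t + β) ^ 2)]
  exact this.2

lemma L2.mono {f : ℝ → ℝ → ℝ} {I J : Set ℝ} {M N : ℝ} (h : L2 f I M) (hJ : J ⊆ I) (hM : M ≤ N) :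
    L2 f J N := fun t ht => ⟨(h t (hJ ht)).1, (h t (hJ ht)).2.trans hM⟩

lemma L2.add {f g : ℝ → ℝ → ℝ} {I : Set ℝ} {M N : ℝ} (hf : Cn f) (hg : Cn g)
    (h : L2 f I M) (h' : L2 g I N) : L2 (fun x t => f x t + g x t) I (2 * M + 2 * N) := by
  refine L2_of_le (g := fun x t => 2 * f x t ^ 2 + 2 * g x t ^ 2) (hf.add hg) ?_ ?_
  · intro t ht
    have h1 := (h t ht).1.const_mul 2
    have h2 := (h' t ht).1.const_mul 2
    refine ⟨h1.add h2, ?_⟩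
    rw [integral_add h1 h2, integral_const_mul, integral_const_mul]
    linarith [(h t ht).2, (h' t ht).2]
  · intro x t _
    nlinarith [sq_nonneg (f x t - g x t)]

lemma L2.smul {f : ℝ → ℝ → ℝ} {I : Set ℝ} {M : ℝ} (h : L2 f I M) (c : ℝ) :
    L2 (fun x t => c * f x t) I (c ^ 2 * M) := by
  intro t ht
  simp only [mul_pow]
  refine ⟨(h t ht).1.const_mul _, ?_⟩
  rw [integral_const_mul]
  exact mul_le_mul_of_nonneg_left (h t ht).2 (sq_nonneg c)

lemma L2.sub {f g : ℝ → ℝ → ℝ} {I : Set ℝ} {M N : ℝ} (hf : Cn f) (hg : Cn g)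
    (h : L2 f I M) (h' : L2 g I N) : L2 (fun x t => f x t - g x t) I (2 * M + 2 * N) := by
  have := L2.add hf (g := fun x t => -1 * g x t) (continuous_const.mul hg) h (h'.smul (-1))
  convert this using 3 <;> ring

/-- the strip measure -/
noncomputable abbrev st (t0 t1 : ℝ) : Measure (ℝ × ℝ) :=
  (volume : Measure ℝ).prod (volume.restrict (Set.Ioc t0 t1))

lemma L2.strip {f : ℝ → ℝ → ℝ} {t0 t1 M : ℝ} (ht : t0 ≤ t1) (hf : Cn f)
    (h : L2 f (Set.Icc t0 t1) M) :
    Integrable (fun p : ℝ × ℝ => f p.1 p.2 ^ 2) (st t0 t1) ∧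
      ∫ p, f p.1 p.2 ^ 2 ∂(st t0 t1) ≤ (t1 - t0) * M := by
  have hc := hf.sq
  have hI : Integrable (fun p : ℝ × ℝ => f p.1 p.2 ^ 2) (st t0 t1) := by
    rw [integrable_prod_iff' hc.aestronglyMeasurable]
    constructor
    · filter_upwards [ae_restrict_mem measurableSet_Ioc] with s hs
      exact (h s (Set.Ioc_subset_Icc_self hs)).1
    · refine Integrable.mono' (g := fun _ => M) (integrable_const _) ?_ ?_
      · exact (hc.norm.stronglyMeasurable.integral_prod_left').aestronglyMeasurable
      · filter_upwards [ae_restrict_mem measurableSet_Ioc] with s hs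
        simp only [Real.norm_of_nonneg (sq_nonneg _)]
        rw [Real.norm_of_nonneg (integral_nonneg fun x => sq_nonneg _)]
        exact (h s (Set.Ioc_subset_Icc_self hs)).2
  refine ⟨hI, ?_⟩
  rw [integral_prod_symm _ hI]
  calc _ ≤ ∫ s in Set.Ioc t0 t1, M := by
        refine setIntegral_mono_on hI.integral_prod_right (integrable_const _)
          measurableSet_Ioc ?_
        intro s hs
        exact (h s (Set.Ioc_subset_Icc_self hs)).2
    _ = (t1 - t0) * M := by simp [ht]

lemma int_mul {f g : ℝ → ℝ → ℝ} {μ : Measure (ℝ × ℝ)} (hf : Cn f) (hg : Cn g)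
    (h : Integrable (fun p : ℝ × ℝ => f p.1 p.2 ^ 2) μ)
    (h' : Integrable (fun p : ℝ × ℝ => g p.1 p.2 ^ 2) μ) :
    Integrable (fun p : ℝ × ℝ => f p.1 p.2 * g p.1 p.2) μ := by
  refine (h.add h').mono' (hf.mul hg).aestronglyMeasurable (Eventually.of_forall fun p => ?_)
  simp only [Pi.add_apply, Real.norm_eq_abs]
  rw [abs_le]
  constructor <;> nlinarith [sq_nonneg (f p.1 p.2 - g p.1 p.2), sq_nonneg (f p.1 p.2 + g p.1 p.2)]

lemma int_mul1 {f g : ℝ → ℝ} (hf : Continuous f) (hg : Continuous g)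
    (h : Integrable (fun p => f p ^ 2))
    (h' : Integrable (fun p => g p ^ 2)) :
    Integrable (fun p => f p * g p) := by
  refine (h.add h').mono' (hf.mul hg).aestronglyMeasurable (Eventually.of_forall fun p => ?_)
  simp only [Pi.add_apply, Real.norm_eq_abs]
  rw [abs_le]
  constructor <;> nlinarith [sq_nonneg (f p - g p), sq_nonneg (f p + g p)]

/-- conservation law with source on a strip -/
lemma flux_law {E Et Fl Fx S : ℝ → ℝ → ℝ} {t0 t1 : ℝ} (ht : t0 ≤ t1)
    (hEt : Cn Et) (hFl : Cn Fl) (hFx : Cn Fx)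
    (dE : ∀ x t, HasDerivAt (fun τ => E x τ) (Et x t) t)
    (dF : ∀ x t, HasDerivAt (fun y => Fl y t) (Fx x t) x)
    (i0 : Integrable (fun x => E x t0)) (i1 : Integrable (fun x => E x t1))
    (iF : Integrable (fun p : ℝ × ℝ => Fl p.1 p.2) (st t0 t1))
    (iS : Integrable (fun p : ℝ × ℝ => S p.1 p.2) (st t0 t1))
    (heq : ∀ x, ∀ t ∈ Set.Icc t0 t1, Et x t + Fx x t = S x t) :
    ∫ x, E x t1 = (∫ x, E x t0) + ∫ p, S p.1 p.2 ∂(st t0 t1) := by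
  have hd : ∀ x, HasDerivAt (fun y => ∫ s in t0..t1, Fl y s)
      ((∫ s in Set.Ioc t0 t1, S x s) - (E x t1 - E x t0)) x := by
    intro x
    have h1 := hasDerivAt_param Fl Fx hFl hFx dF t0 t1 x
    convert h1 using 1
    rw [← intervalIntegral.integral_eq_sub_of_hasDerivAt (fun t _ => dE x t)
      ((hEt.slt x).intervalIntegrable _ _), ← intervalIntegral.integral_of_le ht]
    have : ∫ s in t0..t1, S x s = ∫ s in t0..t1, (Et x s + Fx x s) := by
      refine intervalIntegral.integral_congr fun s hs => ?_
      rw [Set.uIcc_of_le ht] at hs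
      exact (heq x s hs).symm
    rw [this, intervalIntegral.integral_add ((hEt.slt x).intervalIntegrable _ _)
      ((hFx.slt x).intervalIntegrable _ _)]
    ring
  have hfi : Integrable (fun y => ∫ s in t0..t1, Fl y s) := by
    simp only [intervalIntegral.integral_of_le ht]
    exact iF.integral_prod_left
  have hSi : Integrable (fun x => ∫ s in Set.Ioc t0 t1, S x s) := iS.integral_prod_left
  have i2 : Integrable (fun x => E x t1 - E x t0) := i1.sub i0
  have := integral_eq_zero_of_hasDerivAt_of_integrable hd (hSi.sub i2) hfi
  rw [integral_sub hSi i2, integral_sub i1 i0] at this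
  rw [integral_prod _ iS]
  linarith

open MeasureTheory Filter Topology
set_option linter.unusedVariables false

noncomputable def En (ε lam a u v : ℝ) : ℝ :=
  lam ^ 2 / 2 * u ^ 2 + ε ^ 2 / 2 * v ^ 2 - ε ^ 2 * a * u * v

noncomputable def Fn (ε lam a u v : ℝ) : ℝ :=
  -(lam ^ 2 * a / 2) * u ^ 2 - ε ^ 2 * a / 2 * v ^ 2 + lam ^ 2 * u * v

lemma En_lower {ε lam a : ℝ} (h : ε ^ 2 * a ^ 2 ≤ lam ^ 2 / 4) (u v : ℝ) :
    lam ^ 2 * u ^ 2 + ε ^ 2 * v ^ 2 ≤ 4 * En ε lam a u v := by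
  unfold En
  nlinarith [mul_le_mul_of_nonneg_right h (sq_nonneg u), sq_nonneg (ε * (2 * a * u - v))]

lemma En_upper {ε lam a : ℝ} (h : ε ^ 2 * a ^ 2 ≤ lam ^ 2 / 4) (u v : ℝ) :
    En ε lam a u v ≤ lam ^ 2 * u ^ 2 + ε ^ 2 * v ^ 2 := by
  unfold En
  nlinarith [mul_le_mul_of_nonneg_right h (sq_nonneg u), sq_nonneg (ε * (2 * a * u + v)),
    sq_nonneg (ε * v), sq_nonneg (lam * u)]

lemma En_nonneg {ε lam a : ℝ} (h : ε ^ 2 * a ^ 2 ≤ lam ^ 2 / 4) (u v : ℝ) :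
    0 ≤ En ε lam a u v := by
  nlinarith [En_lower h u v, sq_nonneg (lam * u), sq_nonneg (ε * v)]

/-- entropy identity, raw version -/
lemma entropy_raw {ε lam a t0 t1 : ℝ} (ht : t0 ≤ t1) {U Ux Ut V Vx Vt f g : ℝ → ℝ → ℝ}
    (hU : C1 U Ux Ut) (hV : C1 V Vx Vt)
    (e1 : ∀ x, ∀ t ∈ Set.Icc t0 t1, Ut x t + Vx x t = g x t)
    (e2 : ∀ x, ∀ t ∈ Set.Icc t0 t1,
      ε ^ 2 * Vt x t + lam ^ 2 * Ux x t = a * U x t - V x t + f x t)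
    (i0 : Integrable (fun x => En ε lam a (U x t0) (V x t0)))
    (i1 : Integrable (fun x => En ε lam a (U x t1) (V x t1)))
    (iF : Integrable (fun p : ℝ × ℝ => Fn ε lam a (U p.1 p.2) (V p.1 p.2)) (st t0 t1))
    (iS : Integrable (fun p : ℝ × ℝ => -(V p.1 p.2 - a * U p.1 p.2) ^ 2
      + (V p.1 p.2 - a * U p.1 p.2) * f p.1 p.2
      + (lam ^ 2 * U p.1 p.2 - ε ^ 2 * a * V p.1 p.2) * g p.1 p.2) (st t0 t1)) :
    ∫ x, En ε lam a (U x t1) (V x t1) = (∫ x, En ε lam a (U x t0) (V x t0))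
      + ∫ p, (-(V p.1 p.2 - a * U p.1 p.2) ^ 2
      + (V p.1 p.2 - a * U p.1 p.2) * f p.1 p.2
      + (lam ^ 2 * U p.1 p.2 - ε ^ 2 * a * V p.1 p.2) * g p.1 p.2) ∂(st t0 t1) := by
  have c1 := hU.c
  have c2 := hU.cx
  have c3 := hU.ct
  have c4 := hV.c
  have c5 := hV.cx
  have c6 := hV.ct
  refine flux_law (E := fun x t => En ε lam a (U x t) (V x t))
    (Et := fun x t => lam ^ 2 * U x t * Ut x t + ε ^ 2 * V x t * Vt x t
      - ε ^ 2 * a * (Ut x t * V x t + U x t * Vt x t))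
    (Fl := fun x t => Fn ε lam a (U x t) (V x t))
    (Fx := fun x t => -(lam ^ 2 * a) * U x t * Ux x t - ε ^ 2 * a * V x t * Vx x t
      + lam ^ 2 * (Ux x t * V x t + U x t * Vx x t))
    (S := fun x t => -(V x t - a * U x t) ^ 2 + (V x t - a * U x t) * f x t
      + (lam ^ 2 * U x t - ε ^ 2 * a * V x t) * g x t)
    ht ?_ ?_ ?_ ?_ ?_ i0 i1 iF iS ?_
  · unfold Cn at *; fun_prop
  · unfold Cn Fn at *; fun_prop
  · unfold Cn at *; fun_prop
  · intro x t
    unfold En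
    have h1 := hU.ht x t
    have h2 := hV.ht x t
    have := (((h1.pow 2).const_mul (lam ^ 2 / 2)).add ((h2.pow 2).const_mul (ε ^ 2 / 2))).sub
      ((h1.const_mul (ε ^ 2 * a)).mul h2)
    exact this.congr_deriv (by simp; ring)
  · intro x t
    unfold Fn
    have h1 := hU.hx x t
    have h2 := hV.hx x t
    have := (((h1.pow 2).const_mul (-(lam ^ 2 * a / 2))).sub
      ((h2.pow 2).const_mul (ε ^ 2 * a / 2))).add ((h1.const_mul (lam ^ 2)).mul h2)
    exact this.congr_deriv (by simp; ring)
  · intro x t htt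
    have h1 := e1 x t htt
    have h2 := e2 x t htt
    linear_combination (lam ^ 2 * U x t - ε ^ 2 * a * V x t) * h1 + (V x t - a * U x t) * h2

lemma En_integrable {ε lam a : ℝ} {U V : ℝ → ℝ} (hU : Continuous U) (hV : Continuous V)
    (i : Integrable (fun x => U x ^ 2)) (j : Integrable (fun x => V x ^ 2)) :
    Integrable (fun x => En ε lam a (U x) (V x)) := by
  unfold En
  have := ((i.const_mul (lam ^ 2 / 2)).add (j.const_mul (ε ^ 2 / 2))).sub
    ((int_mul1 hU hV i j).const_mul (ε ^ 2 * a))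
  refine this.congr (Eventually.of_forall fun x => ?_)
  simp; ring

/-- entropy identity for square integrable data -/
lemma entropy_l2 {ε lam a t0 t1 M N : ℝ} (ht : t0 ≤ t1) {U Ux Ut V Vx Vt f g : ℝ → ℝ → ℝ}
    (hU : C1 U Ux Ut) (hV : C1 V Vx Vt) (hf : Cn f) (hg : Cn g)
    (e1 : ∀ x, ∀ t ∈ Set.Icc t0 t1, Ut x t + Vx x t = g x t)
    (e2 : ∀ x, ∀ t ∈ Set.Icc t0 t1,
      ε ^ 2 * Vt x t + lam ^ 2 * Ux x t = a * U x t - V x t + f x t)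
    (lU : L2 U (Set.Icc t0 t1) M) (lV : L2 V (Set.Icc t0 t1) N)
    (lf : Integrable (fun p : ℝ × ℝ => f p.1 p.2 ^ 2) (st t0 t1))
    (lg : Integrable (fun p : ℝ × ℝ => g p.1 p.2 ^ 2) (st t0 t1)) :
    Integrable (fun p : ℝ × ℝ => -(V p.1 p.2 - a * U p.1 p.2) ^ 2
      + (V p.1 p.2 - a * U p.1 p.2) * f p.1 p.2
      + (lam ^ 2 * U p.1 p.2 - ε ^ 2 * a * V p.1 p.2) * g p.1 p.2) (st t0 t1) ∧
    ∫ x, En ε lam a (U x t1) (V x t1) = (∫ x, En ε lam a (U x t0) (V x t0))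
      + ∫ p, (-(V p.1 p.2 - a * U p.1 p.2) ^ 2
      + (V p.1 p.2 - a * U p.1 p.2) * f p.1 p.2
      + (lam ^ 2 * U p.1 p.2 - ε ^ 2 * a * V p.1 p.2) * g p.1 p.2) ∂(st t0 t1) := by
  have sU := (lU.strip ht hU.c).1
  have sV := (lV.strip ht hV.c).1
  have UV := int_mul hU.c hV.c sU sV
  have Uf := int_mul hU.c hf sU lf
  have Vf := int_mul hV.c hf sV lf
  have Ug := int_mul hU.c hg sU lg
  have Vg := int_mul hV.c hg sV lg
  have iS : Integrable (fun p : ℝ × ℝ => -(V p.1 p.2 - a * U p.1 p.2) ^ 2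
      + (V p.1 p.2 - a * U p.1 p.2) * f p.1 p.2
      + (lam ^ 2 * U p.1 p.2 - ε ^ 2 * a * V p.1 p.2) * g p.1 p.2) (st t0 t1) := by
    have := (((((((sV.const_mul (-1)).add (UV.const_mul (2 * a))).add
      (sU.const_mul (-a ^ 2))).add Vf).add (Uf.const_mul (-a))).add
      (Ug.const_mul (lam ^ 2))).add (Vg.const_mul (-(ε ^ 2 * a))))
    refine this.congr (Eventually.of_forall fun x => ?_)
    simp; ring
  have iF : Integrable (fun p : ℝ × ℝ => Fn ε lam a (U p.1 p.2) (V p.1 p.2)) (st t0 t1) := by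
    unfold Fn
    have := ((sU.const_mul (-(lam ^ 2 * a / 2))).sub (sV.const_mul (ε ^ 2 * a / 2))).add
      (UV.const_mul (lam ^ 2))
    refine this.congr (Eventually.of_forall fun x => ?_)
    simp; ring
  have m0 : t0 ∈ Set.Icc t0 t1 := ⟨le_rfl, ht⟩
  have m1 : t1 ∈ Set.Icc t0 t1 := ⟨ht, le_rfl⟩
  exact ⟨iS, entropy_raw ht hU hV e1 e2
    (En_integrable (hU.c.slx _) (hV.c.slx _) (lU _ m0).1 (lV _ m0).1)
    (En_integrable (hU.c.slx _) (hV.c.slx _) (lU _ m1).1 (lV _ m1).1) iF iS⟩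

/-- heat energy identity -/
lemma heat_energy {lam a t0 t1 M N : ℝ} (ht : t0 ≤ t1) {k kx kt kxx : ℝ → ℝ → ℝ}
    (hk : C1 k kx kt) (hkxx : Cn kxx) (dxx : ∀ x t, HasDerivAt (fun y => kx y t) (kxx x t) x)
    (e : ∀ x, ∀ t ∈ Set.Icc t0 t1, kt x t + a * kx x t = lam ^ 2 * kxx x t)
    (lk : L2 k (Set.Icc t0 t1) M) (lx : L2 kx (Set.Icc t0 t1) N) :
    ∫ x, k x t1 ^ 2 = (∫ x, k x t0 ^ 2)
      - 2 * lam ^ 2 * ∫ p, kx p.1 p.2 ^ 2 ∂(st t0 t1) := by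
  have c1 := hk.c
  have c2 := hk.cx
  have c3 := hk.ct
  have sk := (lk.strip ht hk.c).1
  have sx := (lx.strip ht hk.cx).1
  have skx := int_mul hk.c hk.cx sk sx
  have := flux_law (E := fun x t => k x t ^ 2) (Et := fun x t => 2 * k x t * kt x t)
    (Fl := fun x t => a * k x t ^ 2 - 2 * lam ^ 2 * (k x t * kx x t))
    (Fx := fun x t => 2 * a * k x t * kx x t
      - 2 * lam ^ 2 * (kx x t * kx x t + k x t * kxx x t))
    (S := fun x t => -(2 * lam ^ 2) * kx x t ^ 2) ht ?_ ?_ ?_ ?_ ?_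
    (lk _ ⟨le_rfl, ht⟩).1 (lk _ ⟨ht, le_rfl⟩).1 ?_ ?_ ?_
  · rw [this, integral_const_mul]; ring
  · unfold Cn at *; fun_prop
  · unfold Cn at *; fun_prop
  · unfold Cn at *; fun_prop
  · intro x t
    exact ((hk.ht x t).pow 2).congr_deriv (by simp)
  · intro x t
    exact ((((hk.hx x t).pow 2).const_mul a).sub
      (((hk.hx x t).mul (dxx x t)).const_mul (2 * lam ^ 2))).congr_deriv (by simp; ring)
  · exact (sk.const_mul a).sub (skx.const_mul _)
  · exact sx.const_mul _
  · intro x t htt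
    linear_combination 2 * k x t * e x t htt

/-- low frequency control -/
lemma low_freq {k kx : ℝ → ℝ → ℝ} (hk : Cn k) (hkx : Cn kx)
    (h : ∀ x t, HasDerivAt (fun y => k y t) (kx x t) x) (δ x t : ℝ) :
    k x t ^ 2 ≤ 2 * Av δ 0 k x t ^ 2 + 2 * δ ^ 2 * Av δ 0 (fun x t => kx x t ^ 2) x t := by
  have ck : Continuous (fun s => k (x + δ * s) t) := by simpa using hk.line δ 0 x t
  have ckx : Continuous (fun s => kx (x + δ * s) t) := by simpa using hkx.line δ 0 x t
  have h1 : ∫ s in (0:ℝ)..1, (-(k (x + δ * s) t) + δ * ((1 - s) * kx (x + δ * s) t))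
      = (1 - 1) * k (x + δ * 1) t - (1 - 0) * k (x + δ * 0) t := by
    refine intervalIntegral.integral_eq_sub_of_hasDerivAt
      (f := fun s => (1 - s) * k (x + δ * s) t) ?_ ?_
    · intro s _
      have h2 : HasDerivAt (fun s : ℝ => x + δ * s) δ s := by
        simpa using ((hasDerivAt_id s).const_mul δ).const_add x
      have h3 := (h (x + δ * s) t).comp s h2
      have h4 : HasDerivAt (fun s : ℝ => 1 - s) (-1) s := by
        simpa using (hasDerivAt_id s).const_sub 1
      exact (h4.mul h3).congr_deriv (by simp; ring)
    · exact Continuous.intervalIntegrable (by fun_prop) _ _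
  rw [intervalIntegral.integral_add (Continuous.intervalIntegrable (by fun_prop) _ _)
    (Continuous.intervalIntegrable (by fun_prop) _ _), intervalIntegral.integral_neg,
    intervalIntegral.integral_const_mul] at h1
  have h5 := sq_int_le (fun s => (1 - s) * kx (x + δ * s) t) (by fun_prop)
  have h6 : ∫ s in (0:ℝ)..1, ((1 - s) * kx (x + δ * s) t) ^ 2
      ≤ ∫ s in (0:ℝ)..1, kx (x + δ * s) t ^ 2 := by
    refine intervalIntegral.integral_mono_on zero_le_one
      (Continuous.intervalIntegrable (by fun_prop) _ _)
      (Continuous.intervalIntegrable (by fun_prop) _ _) ?_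
    intro s hs
    rw [mul_pow]
    have : (1 - s) ^ 2 ≤ 1 := by nlinarith [hs.1, hs.2]
    nlinarith [sq_nonneg (kx (x + δ * s) t)]
  simp only [Av, zero_mul, add_zero]
  simp only [mul_zero, add_zero, sub_zero, one_mul, sub_self, zero_mul, zero_sub] at h1
  set A := ∫ s in (0:ℝ)..1, k (x + δ * s) t
  set B := ∫ s in (0:ℝ)..1, (1 - s) * kx (x + δ * s) t
  set C := ∫ s in (0:ℝ)..1, kx (x + δ * s) t ^ 2
  have hk' : k x t = A - δ * B := by linarith
  have h7 : B ^ 2 ≤ C := h5.trans h6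
  rw [hk']
  nlinarith [sq_nonneg (A + δ * B), mul_le_mul_of_nonneg_left h7 (sq_nonneg δ)]

lemma low_freq_int {k kx : ℝ → ℝ → ℝ} (hk : Cn k) (hkx : Cn kx)
    (h : ∀ x t, HasDerivAt (fun y => k y t) (kx x t) x) (δ : ℝ) {t0 t1 M N P : ℝ} (ht : t0 ≤ t1)
    (lk : L2 k (Set.Icc t0 t1) M) (lx : L2 kx (Set.Icc t0 t1) N)
    (lA : L2 (Av δ 0 k) (Set.Icc t0 t1) P) :
    ∫ p, k p.1 p.2 ^ 2 ∂(st t0 t1) ≤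
      2 * ((t1 - t0) * P) + 2 * δ ^ 2 * ∫ p, kx p.1 p.2 ^ 2 ∂(st t0 t1) := by
  have sk := (lk.strip ht hk).1
  have sx := (lx.strip ht hkx).1
  have sA := lA.strip ht (hk.av δ 0)
  have hsl : ∀ t ∈ Set.Ioc t0 t1, ∫ x, k x t ^ 2 ≤
      2 * (∫ x, Av δ 0 k x t ^ 2) + 2 * δ ^ 2 * ∫ x, kx x t ^ 2 := by
    intro t htt
    have htt := Set.Ioc_subset_Icc_self htt
    obtain ⟨i1, i2⟩ := Av_int hkx.sq (fun x t => sq_nonneg _) δ 0 t (∫ x, kx x t ^ 2)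
      (fun s _ => by simpa using (lx t htt).1)
    have j1 := ((lA t htt).1.const_mul 2)
    have j2 := i1.const_mul (2 * δ ^ 2)
    have := integral_mono (lk t htt).1 (j1.add j2) (fun x => low_freq hk hkx h δ x t)
    simp only [Pi.add_apply] at this
    rw [integral_add j1 j2, integral_const_mul, integral_const_mul] at this
    nlinarith [sq_nonneg δ]
  rw [integral_prod_symm _ sk, integral_prod_symm _ sx]
  have hA := sA.2
  rw [integral_prod_symm _ sA.1] at hA
  have q1 := sA.1.integral_prod_right.const_mul 2
  have q2 := sx.integral_prod_right.const_mul (2 * δ ^ 2)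
  have := setIntegral_mono_on sk.integral_prod_right (q1.add q2) measurableSet_Ioc hsl
  simp only [Pi.add_apply] at this
  rw [integral_add q1 q2, integral_const_mul, integral_const_mul] at this
  linarith

noncomputable def repN (lam a M1 M2 M3 : ℝ) : ℝ :=
  2 * (2 * ((lam ^ 2) ^ 2 * M3) + 2 * ((-a) ^ 2 * M1)) + 2 * M2

noncomputable def repC (ε lam a T' M1 M2 M3 : ℝ) : ℝ :=
  2 * (2 * M2 + 2 * M2) + 2 * ((T' / ε ^ 2) ^ 2 * repN lam a M1 M2 M3)

/-- time differences of `b` are controlled by the error -/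
lemma rep_bound {ε lam a T' s M1 M2 M3 : ℝ} (hε : 0 < ε) (hs : 0 ≤ s) (hsT : s ≤ T')
    {U Ux Ut V Vx Vt b bx bt : ℝ → ℝ → ℝ}
    (hU : C1 U Ux Ut) (hV : C1 V Vx Vt) (hb : C1 b bx bt)
    (e2 : ∀ x, ∀ t ∈ Set.Icc 0 T',
      ε ^ 2 * Vt x t + lam ^ 2 * Ux x t = a * U x t - V x t - ε ^ 2 * bt x t)
    (lU : L2 U (Set.Icc 0 T') M1) (lV : L2 V (Set.Icc 0 T') M2) (lX : L2 Ux (Set.Icc 0 T') M3) :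
    L2 (fun x t => b x t - b x (t + s)) (Set.Icc 0 (T' - s)) (repC ε lam a T' M1 M2 M3) := by
  set G : ℝ → ℝ → ℝ := fun x t => lam ^ 2 * Ux x t + (-a) * U x t + V x t with hG
  have c1 := hU.c
  have c2 := hU.cx
  have c3 := hU.ct
  have c4 := hV.c
  have c5 := hV.cx
  have c6 := hV.ct
  have cG : Cn G := by unfold Cn at *; fun_prop
  have lG : L2 G (Set.Icc 0 T') (repN lam a M1 M2 M3) :=
    L2.add (by unfold Cn at *; fun_prop) c4
      (L2.add (by unfold Cn at *; fun_prop) (by unfold Cn at *; fun_prop)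
        (lX.smul _) (lU.smul _)) lV
  have hT' : 0 ≤ T' := hs.trans hsT
  have lAG : L2 (Av 0 s G) (Set.Icc 0 (T' - s)) (repN lam a M1 M2 M3) := by
    refine lG.av cG 0 s ?_
    intro t ht r hr
    have h1 := mul_nonneg hs hr.1
    have h2 := mul_le_mul_of_nonneg_left hr.2 hs
    exact ⟨by linarith [ht.1], by linarith [ht.2]⟩
  have l1 : L2 (fun x t => V (x + 0) (t + s)) (Set.Icc 0 (T' - s)) M2 :=
    lV.sh 0 s fun t ht => ⟨by linarith [ht.1], by linarith [ht.2]⟩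
  have l2 : L2 V (Set.Icc 0 (T' - s)) M2 :=
    lV.mono (Set.Icc_subset_Icc le_rfl (by linarith)) le_rfl
  have l3 := L2.add ((c4.sh 0 s).sub c4) (continuous_const.mul (cG.av 0 s))
    (L2.sub (c4.sh 0 s) c4 l1 l2) (lAG.smul (s / ε ^ 2))
  have hN : 0 ≤ repN lam a M1 M2 M3 :=
    le_trans (integral_nonneg fun x => sq_nonneg _) (lG 0 ⟨le_rfl, hT'⟩).2
  have hle : 2 * (2 * M2 + 2 * M2) + 2 * ((s / ε ^ 2) ^ 2 * repN lam a M1 M2 M3)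
      ≤ repC ε lam a T' M1 M2 M3 := by
    unfold repC
    gcongr
  have l4 := l3.mono le_rfl hle
  intro t ht
  have key : ∀ x, b x t - b x (t + s) = V (x + 0) (t + s) - V x t + s / ε ^ 2 * Av 0 s G x t := by
    intro x
    have hb' := Av_ft hb.ct hb.ht s x t
    have hV' := Av_ft hV.ct hV.ht s x t
    have : Av 0 s G x t = -(ε ^ 2) * Av 0 s bt x t - ε ^ 2 * Av 0 s Vt x t := by
      simp only [Av]
      rw [← intervalIntegral.integral_const_mul, ← intervalIntegral.integral_const_mul,
        ← intervalIntegral.integral_sub]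
      · refine intervalIntegral.integral_congr fun r hr => ?_
        rw [Set.uIcc_of_le zero_le_one] at hr
        have h1 := mul_nonneg hs hr.1
        have h2 := mul_le_mul_of_nonneg_left hr.2 hs
        have := e2 (x + 0 * r) (t + s * r) ⟨by linarith [ht.1], by linarith [ht.2]⟩
        simp only [hG]
        linarith
      · exact (continuous_const.mul (hb.ct.line 0 s x t)).intervalIntegrable _ _
      · exact (continuous_const.mul (hV.ct.line 0 s x t)).intervalIntegrable _ _
    rw [this, add_zero]
    field_simp
    linarith
  simp only [key]
  exact l4 t ht

open MeasureTheory Filter Topology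
set_option linter.unusedVariables false

/-- the error system together with the heat equation for the reference flux `b` -/
structure Sys (ε lam a T' M : ℝ) (U Ux Ut V Vx Vt b bx bt bxx : ℝ → ℝ → ℝ) : Prop where
  hU : C1 U Ux Ut
  hV : C1 V Vx Vt
  hb : C1 b bx bt
  cxx : Cn bxx
  dxx : ∀ x t, HasDerivAt (fun y => bx y t) (bxx x t) x
  e1 : ∀ x, ∀ t ∈ Set.Icc 0 T', Ut x t + Vx x t = 0
  e2 : ∀ x, ∀ t ∈ Set.Icc 0 T',
      ε ^ 2 * Vt x t + lam ^ 2 * Ux x t = a * U x t - V x t - ε ^ 2 * bt x t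
  e3 : ∀ x, ∀ t ∈ Set.Icc 0 T', bt x t + a * bx x t = lam ^ 2 * bxx x t
  lU : L2 U (Set.Icc 0 T') M
  lV : L2 V (Set.Icc 0 T') M

lemma Av_lin2 {f g : ℝ → ℝ → ℝ} (hf : Cn f) (hg : Cn g) (c d α β x t : ℝ) :
    c * Av α β f x t + d * Av α β g x t = Av α β (fun x t => c * f x t + d * g x t) x t := by
  simp only [Av]
  rw [← intervalIntegral.integral_const_mul, ← intervalIntegral.integral_const_mul,
    ← intervalIntegral.integral_add]
  · exact (continuous_const.mul (hf.line α β x t)).intervalIntegrable _ _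
  · exact (continuous_const.mul (hg.line α β x t)).intervalIntegrable _ _

lemma Av_congr {f g : ℝ → ℝ → ℝ} {α β x t : ℝ}
    (h : ∀ s ∈ Set.Icc (0:ℝ) 1, f (x + α * s) (t + β * s) = g (x + α * s) (t + β * s)) :
    Av α β f x t = Av α β g x t := by
  simp only [Av]
  refine intervalIntegral.integral_congr fun r hr => ?_
  rw [Set.uIcc_of_le zero_le_one] at hr
  exact h r hr

lemma Av_zero_fun (α β x t : ℝ) : Av α β (fun _ _ => 0) x t = 0 := by
  simp [Av]

lemma Sys.av {ε lam a T' M : ℝ} {U Ux Ut V Vx Vt b bx bt bxx : ℝ → ℝ → ℝ}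
    (h : Sys ε lam a T' M U Ux Ut V Vx Vt b bx bt bxx) (δ : ℝ) :
    Sys ε lam a T' M (Av δ 0 U) (Av δ 0 Ux) (Av δ 0 Ut) (Av δ 0 V) (Av δ 0 Vx) (Av δ 0 Vt)
      (Av δ 0 b) (Av δ 0 bx) (Av δ 0 bt) (Av δ 0 bxx) where
  hU := h.hU.av δ 0
  hV := h.hV.av δ 0
  hb := h.hb.av δ 0
  cxx := h.cxx.av δ 0
  dxx := Av_derivx h.hb.cx h.cxx h.dxx δ 0
  e1 := by
    intro x t ht
    have := Av_lin2 h.hU.ct h.hV.cx 1 1 δ 0 x t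
    rw [one_mul, one_mul] at this
    rw [this]
    refine Eq.trans (Av_congr (g := fun _ _ => 0) ?_) (Av_zero_fun δ 0 x t)
    intro s hs
    have := h.e1 (x + δ * s) (t + 0 * s) (by simpa using ht)
    simpa using this
  e2 := by
    intro x t ht
    have h1 := Av_lin2 h.hV.ct h.hU.cx (ε ^ 2) (lam ^ 2) δ 0 x t
    have h2 := Av_lin2 h.hU.c h.hV.c a (-1) δ 0 x t
    have h3 := Av_lin2 (f := fun x t => a * U x t + (-1) * V x t)
      ((continuous_const.mul h.hU.c).add (continuous_const.mul h.hV.c)) h.hb.ct 1 (-ε ^ 2) δ 0 x t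
    have h4 : Av δ 0 (fun x t => ε ^ 2 * Vt x t + lam ^ 2 * Ux x t) x t
        = Av δ 0 (fun x t => 1 * (a * U x t + (-1) * V x t) + (-ε ^ 2) * bt x t) x t := by
      refine Av_congr fun s hs => ?_
      have := h.e2 (x + δ * s) (t + 0 * s) (by simpa using ht)
      rw [this]; ring
    rw [h1, h4, ← h3, ← h2]; ring
  e3 := by
    intro x t ht
    have h1 := Av_lin2 h.hb.ct h.hb.cx 1 a δ 0 x t
    have h2 := Av_lin2 h.cxx h.cxx (lam ^ 2) 0 δ 0 x t
    rw [one_mul] at h1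
    rw [zero_mul, add_zero] at h2
    rw [h1, h2]
    refine Av_congr fun s hs => ?_
    have := h.e3 (x + δ * s) (t + 0 * s) (by simpa using ht)
    linarith
  lU := h.lU.avx h.hU.c δ
  lV := h.lV.avx h.hV.c δ

lemma L2.dq {f : ℝ → ℝ → ℝ} {I : Set ℝ} {M δ : ℝ} (hf : Cn f) (h : L2 f I M)  :
    L2 (fun x t => (f (x + δ) t - f x t) / δ) I ((1 / δ) ^ 2 * (2 * M + 2 * M)) := by
  have h1 : L2 (fun x t => f (x + δ) (t + 0)) I M := h.sh δ 0 (fun t ht => by simpa using ht)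
  have h2 := (L2.sub (hf.sh δ 0) hf h1 h).smul (1 / δ)
  convert h2 using 3
  rw [add_zero]; ring

noncomputable def dC (ε lam a T' M δ : ℝ) : ℝ :=
  repC ε lam a T' M M ((1 / δ) ^ 2 * (2 * M + 2 * M))

lemma Sys.diffAv {ε lam a T' M s δ : ℝ} {U Ux Ut V Vx Vt b bx bt bxx : ℝ → ℝ → ℝ}
    (h : Sys ε lam a T' M U Ux Ut V Vx Vt b bx bt bxx) (hε : 0 < ε) (hδ : δ ≠ 0)
    (hs : 0 ≤ s) (hsT : s ≤ T') :
    L2 (fun x t => Av δ 0 b x t - Av δ 0 b x (t + s)) (Set.Icc 0 (T' - s))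
      (dC ε lam a T' M δ) := by
  have k := h.av δ
  refine rep_bound hε hs hsT k.hU k.hV k.hb k.e2 k.lU k.lV ?_
  have := L2.dq (δ := δ) h.hU.c h.lU
  intro t ht
  have e : ∀ x, Av δ 0 Ux x t = (U (x + δ) t - U x t) / δ := fun x => Av_fx h.hU.cx h.hU.hx hδ x t
  simp only [e]
  exact this t ht

lemma C1.diff {b bx bt : ℝ → ℝ → ℝ} (h : C1 b bx bt) (s : ℝ) :
    C1 (fun x t => b x t - b x (t + s)) (fun x t => bx x t - bx x (t + s))
      (fun x t => bt x t - bt x (t + s)) := by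
  have := h.sub (h.sh 0 s)
  simpa using this

/-- regularity of the doubly mollified difference -/
lemma Sys.reg {ε lam a T' M s η : ℝ} {U Ux Ut V Vx Vt b bx bt bxx : ℝ → ℝ → ℝ}
    (h : Sys ε lam a T' M U Ux Ut V Vx Vt b bx bt bxx) (hε : 0 < ε) (hη : η ≠ 0)
    (hs : 0 ≤ s) (hsT : s ≤ T') :
    ∃ N, L2 (fun x t => Av η 0 (Av η 0 b) x t - Av η 0 (Av η 0 b) x (t + s)) (Set.Icc 0 (T' - s)) N
      ∧ L2 (fun x t => Av η 0 (Av η 0 bx) x t - Av η 0 (Av η 0 bx) x (t + s))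
        (Set.Icc 0 (T' - s)) N := by
  have h1 := h.diffAv hε hη hs hsT
  have h2 := (h.av η).diffAv hε hη hs hsT
  have c := (h.hb.av η 0)
  have h3 := L2.dq (δ := η) (C1.diff c s).c h1
  refine ⟨max (dC ε lam a T' M η)
    ((1 / η) ^ 2 * (2 * dC ε lam a T' M η + 2 * dC ε lam a T' M η)),
    h2.mono le_rfl (le_max_left _ _), ?_⟩
  refine L2.mono ?_ le_rfl (le_max_right _ _)
  intro t ht
  have e : ∀ x t, Av η 0 (Av η 0 bx) x t = (Av η 0 b (x + η) t - Av η 0 b x t) / η :=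
    fun x t => Av_fx c.cx c.hx hη x t
  have := h3 t ht
  simp only [e]
  have e2 : ∀ x, (Av η 0 b (x + η) t - Av η 0 b x t) / η
    - (Av η 0 b (x + η) (t + s) - Av η 0 b x (t + s)) / η
    = (Av η 0 b (x + η) t - Av η 0 b (x + η) (t + s) - (Av η 0 b x t - Av η 0 b x (t + s))) / η :=
    fun x => by ring
  simp only [e2]
  exact this

/-- M1 -/
lemma Sys.heat {ε lam a T' M s t0 t1 N : ℝ} {U Ux Ut V Vx Vt b bx bt bxx : ℝ → ℝ → ℝ}
    (h : Sys ε lam a T' M U Ux Ut V Vx Vt b bx bt bxx) (hs : 0 ≤ s)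
    (l1 : L2 (fun x t => b x t - b x (t + s)) (Set.Icc 0 (T' - s)) N)
    (l2 : L2 (fun x t => bx x t - bx x (t + s)) (Set.Icc 0 (T' - s)) N)
    (h0 : 0 ≤ t0) (h01 : t0 ≤ t1) (h1 : t1 + s ≤ T') :
    ∫ x, (b x t1 - b x (t1 + s)) ^ 2 = (∫ x, (b x t0 - b x (t0 + s)) ^ 2)
      - 2 * lam ^ 2 * ∫ p, (bx p.1 p.2 - bx p.1 (p.2 + s)) ^ 2 ∂(st t0 t1) := by
  have hsub : Set.Icc t0 t1 ⊆ Set.Icc 0 (T' - s) := Set.Icc_subset_Icc h0 (by linarith)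
  refine heat_energy (a := a) h01 (h.hb.diff s) (kxx := fun x t => bxx x t - bxx x (t + s)) ?_ ?_ ?_
    (l1.mono hsub le_rfl) (l2.mono hsub le_rfl)
  · have := h.cxx.sh 0 s
    simp only [add_zero] at this
    exact h.cxx.sub this
  · intro x t
    exact (h.dxx x t).sub (h.dxx x (t + s))
  · intro x t ht
    have a1 := h.e3 x t ⟨by linarith [ht.1], by linarith [ht.2]⟩
    have a2 := h.e3 x (t + s) ⟨by linarith [ht.1], by linarith [ht.2]⟩
    linarith

open MeasureTheory Filter Topology
set_option linter.unusedVariables false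

lemma int_le3 {α : Type*} [MeasurableSpace α] {μ : Measure α} {f g1 g2 g3 : α → ℝ}
    (hf : Integrable f μ) (h1 : Integrable g1 μ) (h2 : Integrable g2 μ) (h3 : Integrable g3 μ)
    (c1 c2 c3 : ℝ) (h : ∀ p, f p ≤ c1 * g1 p + c2 * g2 p + c3 * g3 p) :
    ∫ p, f p ∂μ ≤ c1 * (∫ p, g1 p ∂μ) + c2 * (∫ p, g2 p ∂μ) + c3 * ∫ p, g3 p ∂μ := by
  have i1 := h1.const_mul c1
  have i2 := h2.const_mul c2
  have i3 := h3.const_mul c3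
  have := integral_mono hf ((i1.add i2).add i3) h
  rw [integral_add' (i1.add i2) i3, integral_add' i1 i2, integral_const_mul, integral_const_mul,
    integral_const_mul] at this
  exact this

lemma L2.diff {f : ℝ → ℝ → ℝ} {T' M s τ : ℝ} (hf : Cn f) (h : L2 f (Set.Icc 0 T') M)
    (hs : 0 ≤ s) (hτ : τ + s ≤ T') :
    L2 (fun x t => f x t - f x (t + s)) (Set.Icc 0 τ) (4 * M) := by
  have h1 : L2 (fun x t => f (x + 0) (t + s)) (Set.Icc 0 τ) M :=
    h.sh 0 s fun t ht => ⟨by linarith [ht.1], by linarith [ht.2]⟩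
  have h2 : L2 f (Set.Icc 0 τ) M := h.mono (Set.Icc_subset_Icc le_rfl (by linarith)) le_rfl
  have h3 := L2.sub hf (hf.sh 0 s) h2 h1
  have e : 2 * M + 2 * M = 4 * M := by ring
  simpa [e] using h3

/-- the lower bound of a strip integral by the final slice of a decreasing quantity -/
lemma strip_ge {f : ℝ → ℝ → ℝ} {τ m : ℝ} (hτ : 0 ≤ τ)
    (hi : Integrable (fun p : ℝ × ℝ => f p.1 p.2 ^ 2) (st 0 τ))
    (h : ∀ t ∈ Set.Ioc 0 τ, m ≤ ∫ x, f x t ^ 2) :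
    τ * m ≤ ∫ p, f p.1 p.2 ^ 2 ∂(st 0 τ) := by
  rw [integral_prod_symm _ hi]
  have h1 : Integrable (fun _ : ℝ => m) (volume.restrict (Set.Ioc 0 τ)) := integrable_const _
  have := setIntegral_mono_on h1 hi.integral_prod_right measurableSet_Ioc h
  simpa [hτ] using this

lemma S_young {ε lam a μ U V k kx c1 : ℝ} (hμ : 0 < μ)
    (hc : c1 = 9 / 2 * (1 + a ^ 2) + 1 / 2 + 3 * (lam ^ 4 + ε ^ 4 * a ^ 2) / (4 * μ)) :
    -(-((V + k) - a * U) ^ 2 + ((V + k) - a * U) * k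
      + (lam ^ 2 * U - ε ^ 2 * a * (V + k)) * kx) ≤
    c1 * U ^ 2 + c1 * V ^ 2 + c1 * k ^ 2 + μ * kx ^ 2 := by
  set A := (V + k) - a * U with hA
  set B := lam ^ 2 * U - ε ^ 2 * a * (V + k) with hB
  have h1 : A ^ 2 ≤ 3 * (V ^ 2 + k ^ 2 + a ^ 2 * U ^ 2) := by
    rw [hA]; nlinarith [sq_nonneg (V - k), sq_nonneg (V + a * U), sq_nonneg (k + a * U)]
  have h2 : B ^ 2 ≤ 3 * (lam ^ 4 * U ^ 2 + ε ^ 4 * a ^ 2 * (V ^ 2 + k ^ 2)) := by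
    rw [hB]
    nlinarith [sq_nonneg (lam ^ 2 * U + ε ^ 2 * a * V), sq_nonneg (lam ^ 2 * U + ε ^ 2 * a * k),
      sq_nonneg (ε ^ 2 * a * V - ε ^ 2 * a * k)]
  have h3 : -(B * kx) ≤ B ^ 2 / (4 * μ) + μ * kx ^ 2 := by
    have : B ^ 2 / (4 * μ) + μ * kx ^ 2 + B * kx = (B + 2 * μ * kx) ^ 2 / (4 * μ) := by
      field_simp; ring
    have h4 : 0 ≤ (B + 2 * μ * kx) ^ 2 / (4 * μ) := by positivity
    linarith
  have h5 : B ^ 2 / (4 * μ) ≤ 3 * (lam ^ 4 + ε ^ 4 * a ^ 2) / (4 * μ) * (U ^ 2 + V ^ 2 + k ^ 2) := by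
    rw [div_mul_eq_mul_div]
    refine div_le_div_of_nonneg_right (h2.trans ?_) (by positivity)
    have : 0 ≤ lam ^ 4 * (V ^ 2 + k ^ 2) := by positivity
    have : 0 ≤ ε ^ 4 * a ^ 2 * U ^ 2 := by positivity
    nlinarith
  have h6 : -(A * k) ≤ A ^ 2 / 2 + k ^ 2 / 2 := by nlinarith [sq_nonneg (A + k)]
  have h7 : A ^ 2 ≤ 3 * (1 + a ^ 2) * (U ^ 2 + V ^ 2 + k ^ 2) := by
    have : 0 ≤ a ^ 2 * (V ^ 2 + k ^ 2) := by positivity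
    nlinarith [sq_nonneg U]
  rw [hc]
  set D := 3 * (lam ^ 4 + ε ^ 4 * a ^ 2) / (4 * μ)
  nlinarith [sq_nonneg U, sq_nonneg V]

set_option maxHeartbeats 1600000 in
/-- M2: uniform bound of the differences at time zero -/
lemma main_bound {ε lam a T' τ M : ℝ} (hε : 0 < ε) (hlam : 0 < lam)
    (hsm : ε ^ 2 * a ^ 2 ≤ lam ^ 2 / 4) (hτ : 0 < τ) :
    ∃ C0 : ℝ, ∀ U Ux Ut V Vx Vt b bx bt bxx : ℝ → ℝ → ℝ,
      Sys ε lam a T' M U Ux Ut V Vx Vt b bx bt bxx → ∀ s N : ℝ, 0 ≤ s → τ + s ≤ T' →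
      L2 (fun x t => b x t - b x (t + s)) (Set.Icc 0 (T' - s)) N →
      L2 (fun x t => bx x t - bx x (t + s)) (Set.Icc 0 (T' - s)) N →
      ∫ x, (b x 0 - b x (0 + s)) ^ 2 ≤ C0 := by
  obtain ⟨μ, hμd⟩ : ∃ μ, μ = ε ^ 2 * lam ^ 2 / 16 := ⟨_, rfl⟩
  have hμ : 0 < μ := by rw [hμd]; positivity
  obtain ⟨c1, hc1⟩ : ∃ c1, c1 = 9 / 2 * (1 + a ^ 2) + 1 / 2
    + 3 * (lam ^ 4 + ε ^ 4 * a ^ 2) / (4 * μ) := ⟨_, rfl⟩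
  have hc1p : 0 < c1 := by rw [hc1]; positivity
  obtain ⟨A0, hA0⟩ : ∃ A0, A0 = 2 * ε ^ 2 / τ + c1 := ⟨_, rfl⟩
  have hA0p : 0 < A0 := by rw [hA0]; positivity
  obtain ⟨δ, hδ, hδ2⟩ : ∃ δ : ℝ, 0 < δ ∧ A0 * δ ^ 2 = lam ^ 2 * ε ^ 2 / 32 := by
    refine ⟨Real.sqrt (lam ^ 2 * ε ^ 2 / 32 / A0), by positivity, ?_⟩
    rw [Real.sq_sqrt (by positivity)]
    field_simp
  set P := dC ε lam a T' M δ with hP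
  refine ⟨16 / ε ^ 2 * (9 * ε ^ 2 * M + 4 * lam ^ 2 * M + 8 * c1 * M * τ + A0 * (2 * (τ * P))), ?_⟩
  intro U Ux Ut V Vx Vt b bx bt bxx h s N hs hsT l1 l2
  have hsub : Set.Icc 0 τ ⊆ Set.Icc 0 (T' - s) := Set.Icc_subset_Icc le_rfl (by linarith)
  have l1' := l1.mono hsub le_rfl
  have l2' := l2.mono hsub le_rfl
  have lU := L2.diff h.hU.c h.lU hs hsT
  have lV := L2.diff h.hV.c h.lV hs hsT
  have CU := h.hU.diff s
  have CV := h.hV.diff s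
  have Cb := h.hb.diff s
  have sU := lU.strip hτ.le CU.c
  have sV := lV.strip hτ.le CV.c
  have sk := l1'.strip hτ.le Cb.c
  have skx := l2'.strip hτ.le Cb.cx
  have lZ := L2.add CV.c Cb.c lV l1'
  have CZ := CV.add Cb
  obtain ⟨iS, hS⟩ := entropy_l2 (ε := ε) (lam := lam) (a := a) hτ.le CU CZ Cb.c Cb.cx
    (by
      intro x t ht
      have a1 := h.e1 x t ⟨by linarith [ht.1], by linarith [ht.2]⟩
      have a2 := h.e1 x (t + s) ⟨by linarith [ht.1], by linarith [ht.2]⟩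
      linarith)
    (by
      intro x t ht
      have a1 := h.e2 x t ⟨by linarith [ht.1], by linarith [ht.2]⟩
      have a2 := h.e2 x (t + s) ⟨by linarith [ht.1], by linarith [ht.2]⟩
      linarith) lU lZ sk.1 skx.1
  have m0 : (0:ℝ) ∈ Set.Icc 0 τ := ⟨le_rfl, hτ.le⟩
  have m1 : τ ∈ Set.Icc 0 τ := ⟨hτ.le, le_rfl⟩
  have heat := fun t0 t1 => h.heat (t0 := t0) (t1 := t1) hs l1 l2
  -- names
  obtain ⟨X, hX⟩ : ∃ X, X = ∫ x, (b x 0 - b x (0 + s)) ^ 2 := ⟨_, rfl⟩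
  obtain ⟨J, hJ⟩ : ∃ J, J = ∫ p, (b p.1 p.2 - b p.1 (p.2 + s)) ^ 2 ∂(st 0 τ) := ⟨_, rfl⟩
  obtain ⟨Y, hY⟩ : ∃ Y, Y = ∫ p, (bx p.1 p.2 - bx p.1 (p.2 + s)) ^ 2 ∂(st 0 τ) := ⟨_, rfl⟩
  obtain ⟨R, hR⟩ : ∃ R, R = ∫ x, (b x τ - b x (τ + s)) ^ 2 := ⟨_, rfl⟩
  have hYX : 2 * lam ^ 2 * Y ≤ X := by
    have := heat 0 τ le_rfl hτ.le hsT
    rw [← hX, ← hY, ← hR] at this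
    have h0 : 0 ≤ R := by rw [hR]; exact integral_nonneg fun x => sq_nonneg _
    linarith
  have hRJ : τ * R ≤ J := by
    rw [hJ]
    refine strip_ge (f := fun x t => b x t - b x (t + s)) hτ.le sk.1 ?_
    intro t ht
    have := heat t τ ht.1.le ht.2 hsT
    rw [← hR] at this
    have h0 : 0 ≤ ∫ p, (bx p.1 p.2 - bx p.1 (p.2 + s)) ^ 2 ∂(st t τ) :=
      integral_nonneg fun x => sq_nonneg _
    nlinarith [sq_nonneg lam, mul_nonneg (sq_nonneg lam) h0]
  have hJY : J ≤ 2 * (τ * P) + 2 * δ ^ 2 * Y := by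
    rw [hJ, hY]
    have lA : L2 (Av δ 0 (fun x t => b x t - b x (t + s))) (Set.Icc 0 τ) P := by
      have := (h.diffAv hε hδ.ne' hs (by linarith : s ≤ T')).mono hsub le_rfl
      intro t ht
      have e : ∀ x, Av δ 0 (fun x t => b x t - b x (t + s)) x t
          = Av δ 0 b x t - Av δ 0 b x (t + s) := by
        intro x
        simp only [Av, zero_mul, add_zero]
        have c1 : Continuous (fun r => b (x + δ * r) t) := by simpa using h.hb.c.line δ 0 x t
        have c2 : Continuous (fun r => b (x + δ * r) (t + s)) := by
          simpa using h.hb.c.line δ 0 x (t + s)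
        exact intervalIntegral.integral_sub (c1.intervalIntegrable _ _) (c2.intervalIntegrable _ _)
      simp only [e]
      exact this t ht
    have := low_freq_int Cb.c Cb.cx Cb.hx δ hτ.le l1' l2' lA
    simpa using this
  have hE0 : ε ^ 2 / 8 * X - ε ^ 2 * M ≤ ∫ x, En ε lam a (U x 0 - U x (0 + s))
      (V x 0 - V x (0 + s) + (b x 0 - b x (0 + s))) := by
    have i1 := (l1' 0 m0).1.const_mul (ε ^ 2 / 8)
    have i2 := (lV 0 m0).1.const_mul (ε ^ 2 / 4)
    have : ∫ x, (ε ^ 2 / 8 * (b x 0 - b x (0 + s)) ^ 2 - ε ^ 2 / 4 * (V x 0 - V x (0 + s)) ^ 2)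
        ≤ ∫ x, En ε lam a (U x 0 - U x (0 + s))
      (V x 0 - V x (0 + s) + (b x 0 - b x (0 + s))) := by
      refine integral_mono (i1.sub i2) (En_integrable (CU.c.slx _) (CZ.c.slx _) (lU _ m0).1
        (lZ _ m0).1) fun x => ?_
      have := En_lower hsm (U x 0 - U x (0 + s)) (V x 0 - V x (0 + s) + (b x 0 - b x (0 + s)))
      set p := V x 0 - V x (0 + s)
      set q := b x 0 - b x (0 + s)
      have h1 : 0 ≤ lam ^ 2 * (U x 0 - U x (0 + s)) ^ 2 := by positivity
      have h2 : 0 ≤ ε ^ 2 * (2 * p + q) ^ 2 := by positivity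
      simp only
      nlinarith
    rw [integral_sub i1 i2, integral_const_mul, integral_const_mul, ← hX] at this
    have hv := mul_le_mul_of_nonneg_left (lV 0 m0).2 (sq_nonneg ε)
    linarith
  have hE1 : ∫ x, En ε lam a (U x τ - U x (τ + s)) (V x τ - V x (τ + s) + (b x τ - b x (τ + s)))
      ≤ 4 * lam ^ 2 * M + 8 * ε ^ 2 * M + 2 * ε ^ 2 * R := by
    have := int_le3 (En_integrable (ε := ε) (lam := lam) (a := a) (CU.c.slx _) (CZ.c.slx _)
      (lU _ m1).1 (lZ _ m1).1) (lU τ m1).1 (lV τ m1).1 (l1' τ m1).1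
      (lam ^ 2) (2 * ε ^ 2) (2 * ε ^ 2) (fun x => by
        have := En_upper hsm (U x τ - U x (τ + s)) (V x τ - V x (τ + s) + (b x τ - b x (τ + s)))
        set p := V x τ - V x (τ + s)
        set q := b x τ - b x (τ + s)
        have h2 : 0 ≤ ε ^ 2 * (p - q) ^ 2 := by positivity
        simp only
        linarith)
    rw [← hR] at this
    have hv := mul_le_mul_of_nonneg_left (lV τ m1).2 (sq_nonneg ε)
    have hu := mul_le_mul_of_nonneg_left (lU τ m1).2 (sq_nonneg lam)
    linarith
  have j1 := sU.1.const_mul c1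
  have j2 := sV.1.const_mul c1
  have j3 := sk.1.const_mul c1
  have j4 := skx.1.const_mul μ
  have j12 := j1.add j2
  have j123 := j12.add j3
  have hSS := integral_mono iS.neg (j123.add j4) (fun p => S_young (ε := ε) (lam := lam) (a := a)
      (U := U p.1 p.2 - U p.1 (p.2 + s)) (V := V p.1 p.2 - V p.1 (p.2 + s))
      (k := b p.1 p.2 - b p.1 (p.2 + s)) (kx := bx p.1 p.2 - bx p.1 (p.2 + s)) hμ hc1)
  rw [integral_neg', integral_add' j123 j4, integral_add' j12 j3, integral_add' j1 j2,
    integral_const_mul,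
    integral_const_mul, integral_const_mul, integral_const_mul, ← hJ, ← hY] at hSS
  have hu := sU.2
  have hv := sV.2
  rw [← hX]
  have hSX : ε ^ 2 / 8 * X - ε ^ 2 * M ≤ 4 * lam ^ 2 * M + 8 * ε ^ 2 * M + 2 * ε ^ 2 * R
      + (c1 * (τ * (4 * M)) + c1 * (τ * (4 * M)) + c1 * J + μ * Y) := by
    rw [sub_zero] at hu hv
    have hu' := mul_le_mul_of_nonneg_left hu hc1p.le
    have hv' := mul_le_mul_of_nonneg_left hv hc1p.le
    linarith
  have q1 : 2 * ε ^ 2 * R ≤ 2 * ε ^ 2 / τ * J := by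
    rw [div_mul_eq_mul_div, le_div_iff₀ hτ]
    nlinarith [mul_le_mul_of_nonneg_left hRJ (sq_nonneg ε)]
  have q2 : μ * Y ≤ ε ^ 2 / 32 * X := by
    rw [hμd]; nlinarith [mul_le_mul_of_nonneg_left hYX (sq_nonneg ε)]
  have q3 : A0 * J ≤ A0 * (2 * (τ * P)) + ε ^ 2 / 32 * X := by
    have := mul_le_mul_of_nonneg_left hJY hA0p.le
    have e : A0 * (2 * δ ^ 2 * Y) = ε ^ 2 / 32 * (2 * lam ^ 2 * Y) := by
      linear_combination 2 * Y * hδ2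
    have := mul_le_mul_of_nonneg_left hYX (by positivity : 0 ≤ ε ^ 2 / 32)
    linarith
  have q4 : A0 * J = 2 * ε ^ 2 / τ * J + c1 * J := by rw [hA0]; ring
  have q5 : ε ^ 2 / 16 * X ≤ 9 * ε ^ 2 * M + 4 * lam ^ 2 * M + 8 * c1 * M * τ
      + A0 * (2 * (τ * P)) := by linarith
  have q6 : X = 16 / ε ^ 2 * (ε ^ 2 / 16 * X) := by field_simp
  rw [q6]
  exact mul_le_mul_of_nonneg_left q5 (by positivity)

open MeasureTheory Filter Topology
set_option linter.unusedVariables false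

lemma fatou_sq {α : Type*} [MeasurableSpace α] {μ : Measure α} {f : α → ℝ} {F : ℕ → α → ℝ} {C : ℝ}
    (hC : 0 ≤ C) (hm : AEStronglyMeasurable f μ)
    (hF : ∀ n, Integrable (fun x => F n x ^ 2) μ) (hb : ∀ n, ∫ x, F n x ^ 2 ∂μ ≤ C)
    (hlim : ∀ x, Tendsto (fun n => F n x) atTop (𝓝 (f x))) :
    Integrable (fun x => f x ^ 2) μ ∧ ∫ x, f x ^ 2 ∂μ ≤ C := by
  have h1 : ∫⁻ x, ENNReal.ofReal (f x ^ 2) ∂μ ≤ ENNReal.ofReal C := by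
    have e : ∀ x, ENNReal.ofReal (f x ^ 2)
        = liminf (fun n => ENNReal.ofReal (F n x ^ 2)) atTop := fun x =>
      (Tendsto.liminf_eq ((ENNReal.continuous_ofReal.tendsto _).comp ((hlim x).pow 2))).symm
    simp only [e]
    refine (lintegral_liminf_le' fun n => (hF n).1.aemeasurable.ennreal_ofReal).trans ?_
    refine liminf_le_of_le (by isBoundedDefault) fun b hb' => ?_
    obtain ⟨n, hn⟩ := hb'.exists
    refine hn.trans ?_
    rw [← ofReal_integral_eq_lintegral_ofReal (hF n) (Eventually.of_forall fun x => sq_nonneg _)]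
    exact ENNReal.ofReal_le_ofReal (hb n)
  have hi : Integrable (fun x => f x ^ 2) μ := by
    refine ⟨hm.pow 2, ?_⟩
    rw [hasFiniteIntegral_iff_ofReal (Eventually.of_forall fun x => sq_nonneg _)]
    exact h1.trans_lt ENNReal.ofReal_lt_top
  refine ⟨hi, ?_⟩
  rw [← ofReal_integral_eq_lintegral_ofReal hi (Eventually.of_forall fun x => sq_nonneg _)] at h1
  exact (ENNReal.ofReal_le_ofReal_iff hC).1 h1

lemma Av_cont_param {f : ℝ → ℝ → ℝ} (hf : Cn f) (t : ℝ) :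
    Continuous (fun q : ℝ × ℝ => Av q.1 0 f q.2 t) := by
  refine intervalIntegral.continuous_parametric_intervalIntegral_of_continuous'
    (f := fun (q : ℝ × ℝ) s => f (q.2 + q.1 * s) (t + 0 * s)) ?_ 0 1
  exact hf.comp (by fun_prop : Continuous (fun r : (ℝ × ℝ) × ℝ =>
    (r.1.2 + r.1.1 * r.2, t + 0 * r.2)))

lemma Av2_cont {f : ℝ → ℝ → ℝ} (hf : Cn f) (x t : ℝ) :
    Continuous (fun η : ℝ => Av η 0 (Av η 0 f) x t) := by
  refine intervalIntegral.continuous_parametric_intervalIntegral_of_continuous'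
    (f := fun (η : ℝ) s => Av η 0 f (x + η * s) (t + 0 * s)) ?_ 0 1
  have e : (Function.uncurry fun (η : ℝ) s => Av η 0 f (x + η * s) (t + 0 * s))
      = fun r : ℝ × ℝ => Av r.1 0 f (x + r.1 * r.2) t := by
    ext r; simp [Function.uncurry]
  rw [e]
  exact (Av_cont_param hf t).comp (by fun_prop : Continuous (fun r : ℝ × ℝ =>
    (r.1, x + r.1 * r.2)))

lemma Av2_tendsto {f : ℝ → ℝ → ℝ} (hf : Cn f) (x t : ℝ) :
    Tendsto (fun n : ℕ => Av (1 / ((n:ℝ) + 1)) 0 (Av (1 / ((n:ℝ) + 1)) 0 f) x t) atTop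
      (𝓝 (f x t)) := by
  have h := ((Av2_cont hf x t).tendsto 0).comp tendsto_one_div_add_atTop_nhds_zero_nat
  have e : Av 0 0 (Av 0 0 f) x t = f x t := by simp [Av]
  rw [e] at h
  exact h

/-- uniform bounds of the differences of the reference flux -/
lemma diff_bounds {ε lam a T : ℝ} (hε : 0 < ε) (hlam : 0 < lam)
    (hsm : ε ^ 2 * a ^ 2 ≤ lam ^ 2 / 4) (hT : 0 < T) {U Ux Ut V Vx Vt b bx bt bxx : ℝ → ℝ → ℝ}
    (h : ∀ T' < T, ∃ M, Sys ε lam a T' M U Ux Ut V Vx Vt b bx bt bxx) :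
    ∃ C : ℝ, 0 ≤ C ∧ ∀ s t : ℝ, 0 ≤ s → s ≤ T / 2 → 0 ≤ t → t + s < T →
      (Integrable (fun x => (b x t - b x (t + s)) ^ 2) ∧
        ∫ x, (b x t - b x (t + s)) ^ 2 ≤ C) ∧
      (Integrable (fun p : ℝ × ℝ => (bx p.1 p.2 - bx p.1 (p.2 + s)) ^ 2) (st 0 t) ∧
        ∫ p, (bx p.1 p.2 - bx p.1 (p.2 + s)) ^ 2 ∂(st 0 t) ≤ C) := by
  obtain ⟨M, hM⟩ := h (3 * T / 4) (by linarith)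
  obtain ⟨C0, hC0⟩ := main_bound (T' := 3 * T / 4) (τ := T / 4) (M := M) hε hlam hsm (by linarith)
  refine ⟨max 0 (max C0 (C0 / (2 * lam ^ 2))), le_max_left _ _, ?_⟩
  intro s t hs hs2 ht hts
  obtain ⟨M', hM'⟩ := h (t + s) hts
  have key : ∀ η : ℝ, η ≠ 0 →
      (Integrable (fun x => (Av η 0 (Av η 0 b) x t - Av η 0 (Av η 0 b) x (t + s)) ^ 2) ∧
        ∫ x, (Av η 0 (Av η 0 b) x t - Av η 0 (Av η 0 b) x (t + s)) ^ 2 ≤ C0) ∧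
      (Integrable (fun p : ℝ × ℝ =>
          (Av η 0 (Av η 0 bx) p.1 p.2 - Av η 0 (Av η 0 bx) p.1 (p.2 + s)) ^ 2) (st 0 t) ∧
        ∫ p, (Av η 0 (Av η 0 bx) p.1 p.2 - Av η 0 (Av η 0 bx) p.1 (p.2 + s)) ^ 2 ∂(st 0 t)
          ≤ C0 / (2 * lam ^ 2)) := by
    intro η hη
    obtain ⟨N, n1, n2⟩ := hM.reg hε hη hs (by linarith : s ≤ 3 * T / 4)
    obtain ⟨N', m1, m2⟩ := hM'.reg hε hη hs (by linarith : s ≤ t + s)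
    have b0 := hC0 _ _ _ _ _ _ _ _ _ _ ((hM.av η).av η) s N hs (by linarith) n1 n2
    have b1 := ((hM'.av η).av η).heat hs m1 m2 le_rfl ht le_rfl
    have mt : t ∈ Set.Icc 0 (t + s - s) := ⟨ht, by linarith⟩
    have hcx := (C1.diff ((hM.hb.av η 0).av η 0) s).cx
    have st' := (m2.mono (Set.Icc_subset_Icc le_rfl (by linarith) : Set.Icc 0 t ⊆ _) le_rfl).strip
      ht hcx
    have p1 : 0 ≤ ∫ p, (Av η 0 (Av η 0 bx) p.1 p.2 - Av η 0 (Av η 0 bx) p.1 (p.2 + s)) ^ 2 ∂(st 0 t) :=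
      integral_nonneg fun _ => sq_nonneg _
    have p2 : 0 ≤ ∫ x, (Av η 0 (Av η 0 b) x t - Av η 0 (Av η 0 b) x (t + s)) ^ 2 :=
      integral_nonneg fun _ => sq_nonneg _
    refine ⟨⟨(m1 t mt).1, ?_⟩, st'.1, ?_⟩
    · have : 0 ≤ 2 * lam ^ 2 *
        ∫ p, (Av η 0 (Av η 0 bx) p.1 p.2 - Av η 0 (Av η 0 bx) p.1 (p.2 + s)) ^ 2 ∂(st 0 t) := by
        positivity
      linarith
    · rw [le_div_iff₀ (by positivity)]
      linarith
  have hη : ∀ n : ℕ, (1 / ((n:ℝ) + 1)) ≠ 0 := fun n => by positivity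
  have cd := hM.hb.diff s
  constructor
  · refine fatou_sq (F := fun n x => Av (1 / ((n:ℝ) + 1)) 0 (Av (1 / ((n:ℝ) + 1)) 0 b) x t
      - Av (1 / ((n:ℝ) + 1)) 0 (Av (1 / ((n:ℝ) + 1)) 0 b) x (t + s)) (le_max_left _ _)
      (cd.c.slx t).aestronglyMeasurable (fun n => (key _ (hη n)).1.1)
      (fun n => (key _ (hη n)).1.2.trans ((le_max_left _ _).trans (le_max_right _ _))) ?_
    intro x
    exact (Av2_tendsto hM.hb.c x t).sub (Av2_tendsto hM.hb.c x (t + s))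
  · refine fatou_sq (F := fun n (p : ℝ × ℝ) =>
      Av (1 / ((n:ℝ) + 1)) 0 (Av (1 / ((n:ℝ) + 1)) 0 bx) p.1 p.2
      - Av (1 / ((n:ℝ) + 1)) 0 (Av (1 / ((n:ℝ) + 1)) 0 bx) p.1 (p.2 + s)) (le_max_left _ _)
      cd.cx.aestronglyMeasurable (fun n => (key _ (hη n)).2.1)
      (fun n => (key _ (hη n)).2.2.trans ((le_max_right _ _).trans (le_max_right _ _))) ?_
    intro p
    exact (Av2_tendsto hM.hb.cx p.1 p.2).sub (Av2_tendsto hM.hb.cx p.1 (p.2 + s))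

open MeasureTheory Filter Topology
set_option linter.unusedVariables false

/-- reference solution with uniform control of differences -/
structure Ref (lam a T C : ℝ) (ub ubx ubt b bx bt : ℝ → ℝ → ℝ) : Prop where
  hT : 0 < T
  hC : 0 ≤ C
  hu : C1 ub ubx ubt
  hb : C1 b bx bt
  e1 : ∀ x, ∀ t ∈ Set.Ico 0 T, ubt x t + bx x t = 0
  e2 : ∀ x, ∀ t ∈ Set.Ico 0 T, lam ^ 2 * ubx x t = a * ub x t - b x t
  hd : ∀ s t : ℝ, 0 ≤ s → s ≤ T / 2 → 0 ≤ t → t + s < T →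
      (Integrable (fun x => (b x t - b x (t + s)) ^ 2) ∧
        ∫ x, (b x t - b x (t + s)) ^ 2 ≤ C) ∧
      (Integrable (fun p : ℝ × ℝ => (bx p.1 p.2 - bx p.1 (p.2 + s)) ^ 2) (st 0 t) ∧
        ∫ p, (bx p.1 p.2 - bx p.1 (p.2 + s)) ^ 2 ∂(st 0 t) ≤ C)

lemma Ref.d2 {lam a T C : ℝ} {ub ubx ubt b bx bt : ℝ → ℝ → ℝ}
    (h : Ref lam a T C ub ubx ubt b bx bt) {s p : ℝ} (hs : 0 ≤ s) (hsT : s ≤ T / 2) (hp : 0 ≤ p)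
    (hpT : p + 2 * s < T) :
    Integrable (fun x => (ub x p - 2 * ub x (p + s) + ub x (p + 2 * s)) ^ 2) ∧
      ∫ x, (ub x p - 2 * ub x (p + s) + ub x (p + 2 * s)) ^ 2 ≤ s * C := by
  obtain ⟨i, hi⟩ := (h.hd s (p + s) hs hsT (by linarith) (by linarith)).2
  have c := h.hu.diff s
  have cx := (h.hb.diff s).cx
  have key : ∀ x, (ub x p - 2 * ub x (p + s) + ub x (p + 2 * s)) ^ 2 ≤
      s * ∫ r in Set.Ioc 0 (p + s), (bx x r - bx x (r + s)) ^ 2 := by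
    intro x
    have h1 := Av_ft c.ct c.ht s x p
    have h2 := mul_le_mul_of_nonneg_left (Av_sq_le c.ct 0 s x p) (sq_nonneg s)
    have h3 : Av 0 s (fun x t => (ubt x t - ubt x (t + s)) ^ 2) x p
        = Av 0 s (fun x t => (bx x t - bx x (t + s)) ^ 2) x p := by
      refine Av_congr fun r hr => ?_
      have q1 := mul_nonneg hs hr.1
      have q2 := mul_le_mul_of_nonneg_left hr.2 hs
      have a1 := h.e1 (x + 0 * r) (p + s * r) ⟨by linarith, by linarith⟩
      have a2 := h.e1 (x + 0 * r) (p + s * r + s) ⟨by linarith, by linarith⟩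
      have : ubt (x + 0 * r) (p + s * r) - ubt (x + 0 * r) (p + s * r + s)
        = -(bx (x + 0 * r) (p + s * r) - bx (x + 0 * r) (p + s * r + s)) := by linarith
      rw [this]; ring
    rw [h3] at h2
    have h4 : s * Av 0 s (fun x t => (bx x t - bx x (t + s)) ^ 2) x p
        = ∫ r in p..(p + s), (bx x r - bx x (r + s)) ^ 2 := by
      have := intervalIntegral.mul_integral_comp_add_mul (a := 0) (b := 1)
        (f := fun r => (bx x r - bx x (r + s)) ^ 2) s p
      simpa [Av] using this
    have h5 : ∫ r in p..(p + s), (bx x r - bx x (r + s)) ^ 2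
        ≤ ∫ r in (0:ℝ)..(p + s), (bx x r - bx x (r + s)) ^ 2 :=
      intervalIntegral.integral_mono_interval hp (by linarith) le_rfl
        (Eventually.of_forall fun r => sq_nonneg _)
        (((cx.slt x).pow 2).intervalIntegrable _ _)
    rw [intervalIntegral.integral_of_le (by linarith : (0:ℝ) ≤ p + s)] at h5
    have e : (ub x p - 2 * ub x (p + s) + ub x (p + 2 * s)) ^ 2
        = s ^ 2 * Av 0 s (fun x t => ubt x t - ubt x (t + s)) x p ^ 2 := by
      rw [← mul_pow, h1]
      have : p + s + s = p + 2 * s := by ring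
      rw [this]; ring
    rw [e]
    refine h2.trans ?_
    rw [sq, mul_assoc, h4]
    exact mul_le_mul_of_nonneg_left h5 hs
  have hi2 := i.integral_prod_left.const_mul s
  have hc : Continuous (fun x => ub x p - 2 * ub x (p + s) + ub x (p + 2 * s)) :=
    ((h.hu.c.slx _).sub (continuous_const.mul (h.hu.c.slx _))).add (h.hu.c.slx _)
  have hI : Integrable (fun x => (ub x p - 2 * ub x (p + s) + ub x (p + 2 * s)) ^ 2) := by
    refine hi2.mono' (hc.pow 2).aestronglyMeasurable (Eventually.of_forall fun x => ?_)
    rw [Real.norm_of_nonneg (sq_nonneg _)]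
    exact key x
  refine ⟨hI, (integral_mono hI hi2 key).trans ?_⟩
  rw [integral_const_mul]
  rw [integral_prod _ i] at hi
  exact mul_le_mul_of_nonneg_left hi hs

lemma Ref.d1' {lam a T C : ℝ} {ub ubx ubt b bx bt : ℝ → ℝ → ℝ}
    (h : Ref lam a T C ub ubx ubt b bx bt) {p q : ℝ} (hp : p ∈ Set.Ico 0 T) (hq : q ∈ Set.Ico 0 T)
    (hpq : |p - q| ≤ T / 2) :
    Integrable (fun x => (b x p - b x q) ^ 2) ∧ ∫ x, (b x p - b x q) ^ 2 ≤ C := by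
  rw [abs_le] at hpq
  rcases le_total p q with hle | hle
  · have := (h.hd (q - p) p (by linarith) (by linarith) hp.1 (by linarith [hq.2])).1
    simpa using this
  · have := (h.hd (p - q) q (by linarith) (by linarith) hq.1 (by linarith [hp.2])).1
    have e : ∀ x, (b x p - b x q) ^ 2 = (b x q - b x p) ^ 2 := fun x => by ring
    simp only [e]
    simpa using this

lemma Ref.d2' {lam a T C : ℝ} {ub ubx ubt b bx bt : ℝ → ℝ → ℝ}
    (h : Ref lam a T C ub ubx ubt b bx bt) {β p : ℝ} (hp : p ∈ Set.Ico 0 T)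
    (hq : p + 2 * β ∈ Set.Ico 0 T) (hβ : |β| ≤ T / 2) :
    Integrable (fun x => (ub x p - 2 * ub x (p + β) + ub x (p + 2 * β)) ^ 2) ∧
      ∫ x, (ub x p - 2 * ub x (p + β) + ub x (p + 2 * β)) ^ 2 ≤ |β| * C := by
  rcases le_total 0 β with hle | hle
  · rw [abs_of_nonneg hle] at *
    exact h.d2 hle hβ hp.1 hq.2
  · rw [abs_of_nonpos hle] at *
    have := h.d2 (s := -β) (p := p + 2 * β) (by linarith) hβ hq.1 (by linarith [hp.2])
    have e1 : p + 2 * β + -β = p + β := by ring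
    have e2 : p + 2 * β + 2 * -β = p := by ring
    rw [e1, e2] at this
    have e : ∀ x, (ub x p - 2 * ub x (p + β) + ub x (p + 2 * β)) ^ 2
      = (ub x (p + 2 * β) - 2 * ub x (p + β) + ub x p) ^ 2 := fun x => by ring
    simp only [e]
    exact this

/-- extrapolated time average -/
noncomputable def tl (β : ℝ) (f : ℝ → ℝ → ℝ) : ℝ → ℝ → ℝ :=
  fun x t => 2 * Av 0 β f x t - Av 0 (2 * β) f x t

lemma C1.tl {f fx ft : ℝ → ℝ → ℝ} (h : C1 f fx ft) (β : ℝ) : C1 (tl β f) (tl β fx) (tl β ft) :=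
  ((h.av 0 β).smul 2).sub (h.av 0 (2 * β))

lemma seg_mem {T t β r : ℝ} (ht : t ∈ Set.Ico 0 T) (h : t + 2 * β ∈ Set.Ico 0 T)
    (hr : r ∈ Set.Icc (0:ℝ) 1) : t + β * r ∈ Set.Ico 0 T ∧ t + 2 * β * r ∈ Set.Ico 0 T := by
  obtain ⟨r0, r1⟩ := hr
  obtain ⟨t0, t1⟩ := ht
  obtain ⟨q0, q1⟩ := h
  have e1 : t + 2 * β * r = (1 - r) * t + r * (t + 2 * β) := by ring
  have e2 : t + β * r = (1 - r / 2) * t + (r / 2) * (t + 2 * β) := by ring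
  rw [e1, e2]
  refine ⟨⟨?_, ?_⟩, ⟨?_, ?_⟩⟩
  · have := mul_nonneg (by linarith : 0 ≤ 1 - r / 2) t0
    have := mul_nonneg (by linarith : 0 ≤ r / 2) q0
    linarith
  · have := mul_le_mul_of_nonneg_left q1.le (by linarith : 0 ≤ r / 2)
    have := mul_lt_mul_of_pos_left t1 (by linarith : 0 < 1 - r / 2)
    linarith
  · have := mul_nonneg (by linarith : 0 ≤ 1 - r) t0
    have := mul_nonneg r0 q0
    linarith
  · rcases r1.lt_or_eq with h | h
    · have := mul_le_mul_of_nonneg_left q1.le r0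
      have := mul_lt_mul_of_pos_left t1 (by linarith : 0 < 1 - r)
      linarith
    · subst h; linarith

lemma tl_eq {f g h : ℝ → ℝ → ℝ} (hf : Cn f) (hg : Cn g) (hh : Cn h) {c d e T t β x : ℝ}
    (ht : t ∈ Set.Ico 0 T) (hq : t + 2 * β ∈ Set.Ico 0 T)
    (H : ∀ x, ∀ t ∈ Set.Ico 0 T, c * f x t + d * g x t = e * h x t) :
    c * tl β f x t + d * tl β g x t = e * tl β h x t := by
  have k : ∀ γ, (∀ r ∈ Set.Icc (0:ℝ) 1, t + γ * r ∈ Set.Ico 0 T) →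
      c * Av 0 γ f x t + d * Av 0 γ g x t = e * Av 0 γ h x t := by
    intro γ hγ
    have h1 := Av_lin2 hf hg c d 0 γ x t
    have h2 := Av_lin2 hh hh e 0 0 γ x t
    rw [zero_mul, add_zero] at h2
    rw [h1, h2]
    refine Av_congr fun r hr => ?_
    simp only [zero_mul, add_zero]
    exact H _ _ (hγ r hr)
  have k1 := k β (fun r hr => (seg_mem ht hq hr).1)
  have k2 := k (2 * β) (fun r hr => (seg_mem ht hq hr).2)
  unfold tl
  linear_combination 2 * k1 - k2

lemma tl_bound {f : ℝ → ℝ → ℝ} (hf : Cn f) {t β M : ℝ}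
    (h : ∀ r ∈ Set.Icc (0:ℝ) 1,
      Integrable (fun x => (f x t - 2 * f x (t + β * r) + f x (t + 2 * (β * r))) ^ 2) ∧
      ∫ x, (f x t - 2 * f x (t + β * r) + f x (t + 2 * (β * r))) ^ 2 ≤ M) :
    Integrable (fun x => (f x t - tl β f x t) ^ 2) ∧ ∫ x, (f x t - tl β f x t) ^ 2 ≤ M := by
  set g : ℝ → ℝ → ℝ := fun x r => f x t - 2 * f x (t + β * r) + f x (t + 2 * (β * r)) with hg
  have cg : Cn g := by
    have c1 : Continuous (fun p : ℝ × ℝ => f p.1 t) :=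
      hf.comp (by fun_prop : Continuous (fun p : ℝ × ℝ => (p.1, t)))
    have c2 : Continuous (fun p : ℝ × ℝ => f p.1 (t + β * p.2)) :=
      hf.comp (by fun_prop : Continuous (fun p : ℝ × ℝ => (p.1, t + β * p.2)))
    have c3 : Continuous (fun p : ℝ × ℝ => f p.1 (t + 2 * (β * p.2))) :=
      hf.comp (by fun_prop : Continuous (fun p : ℝ × ℝ => (p.1, t + 2 * (β * p.2))))
    exact (c1.sub (continuous_const.mul c2)).add c3
  have l : L2 g (Set.Icc 0 1) M := h
  have l2 : L2 (Av 0 1 g) {0} M := l.av cg 0 1 (by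
    intro s hs r hr
    rw [Set.mem_singleton_iff.1 hs]; simpa using hr)
  have e : ∀ x, f x t - tl β f x t = Av 0 1 g x 0 := by
    intro x
    have d2 : Continuous (fun r => f x (t + β * r)) := by simpa using hf.line 0 β x t
    have d3 : Continuous (fun r => f x (t + 2 * (β * r))) := by
      simpa [mul_assoc] using hf.line 0 (2 * β) x t
    simp only [tl, Av, hg, zero_mul, add_zero, zero_add, one_mul]
    rw [intervalIntegral.integral_add (Continuous.intervalIntegrable (by fun_prop) _ _)
      (Continuous.intervalIntegrable (by fun_prop) _ _),
      intervalIntegral.integral_sub (Continuous.intervalIntegrable (by fun_prop) _ _)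
      (Continuous.intervalIntegrable (by fun_prop) _ _), intervalIntegral.integral_const_mul]
    simp [mul_assoc]; ring
  simp only [e]
  exact l2 0 rfl

open MeasureTheory Filter Topology
set_option linter.unusedVariables false

lemma Ref.du {lam a T C : ℝ} {ub ubx ubt b bx bt : ℝ → ℝ → ℝ}
    (h : Ref lam a T C ub ubx ubt b bx bt) {β : ℝ} (hβ : |β| ≤ T / 4) {J : Set ℝ}
    (hJ : ∀ t ∈ J, t ∈ Set.Ico 0 T ∧ t + 2 * β ∈ Set.Ico 0 T) :
    L2 (fun x t => ub x t - tl β ub x t) J (|β| * C) := by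
  intro t ht
  refine tl_bound h.hu.c fun r hr => ?_
  have hs := seg_mem (hJ t ht).1 (hJ t ht).2 hr
  have e : 2 * β * r = 2 * (β * r) := by ring
  have hr' : |β * r| ≤ |β| := by
    rw [abs_mul, abs_of_nonneg hr.1]
    exact mul_le_of_le_one_right (abs_nonneg _) hr.2
  have := h.d2' (β := β * r) (hJ t ht).1 (by rw [← e]; exact hs.2) (by linarith [h.hT])
  exact ⟨this.1, this.2.trans (mul_le_mul_of_nonneg_right hr' h.hC)⟩

lemma Ref.dv {lam a T C : ℝ} {ub ubx ubt b bx bt : ℝ → ℝ → ℝ}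
    (h : Ref lam a T C ub ubx ubt b bx bt) {β : ℝ} (hβ : |β| ≤ T / 4) {J : Set ℝ}
    (hJ : ∀ t ∈ J, t ∈ Set.Ico 0 T ∧ t + 2 * β ∈ Set.Ico 0 T) :
    L2 (fun x t => b x t - tl β b x t) J (4 * C) := by
  intro t ht
  refine tl_bound h.hb.c fun r hr => ?_
  have hs := seg_mem (hJ t ht).1 (hJ t ht).2 hr
  have e : 2 * β * r = 2 * (β * r) := by ring
  have hr' : |β * r| ≤ |β| := by
    rw [abs_mul, abs_of_nonneg hr.1]
    exact mul_le_of_le_one_right (abs_nonneg _) hr.2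
  have h1 := h.d1' (hJ t ht).1 hs.1 (by
    have : t - (t + β * r) = -(β * r) := by ring
    rw [this, abs_neg]; linarith [h.hT])
  have h2 := h.d1' hs.1 hs.2 (by
    have : t + β * r - (t + 2 * β * r) = -(β * r) := by ring
    rw [this, abs_neg]; linarith [h.hT])
  rw [e] at h2
  have c : Continuous (fun x => b x t - 2 * b x (t + β * r) + b x (t + 2 * (β * r))) :=
    ((h.hb.c.slx _).sub (continuous_const.mul (h.hb.c.slx _))).add (h.hb.c.slx _)
  have key : ∀ x, (b x t - 2 * b x (t + β * r) + b x (t + 2 * (β * r))) ^ 2 ≤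
      2 * (b x t - b x (t + β * r)) ^ 2
        + 2 * (b x (t + β * r) - b x (t + 2 * (β * r))) ^ 2 := fun x => by
    nlinarith [sq_nonneg (b x t - b x (t + β * r) + (b x (t + β * r) - b x (t + 2 * (β * r))))]
  have i1 := h1.1.const_mul 2
  have i2 := h2.1.const_mul 2
  have hI : Integrable (fun x => (b x t - 2 * b x (t + β * r) + b x (t + 2 * (β * r))) ^ 2) := by
    refine (i1.add i2).mono' (c.pow 2).aestronglyMeasurable (Eventually.of_forall fun x => ?_)
    rw [Real.norm_of_nonneg (sq_nonneg _)]
    exact key x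
  refine ⟨hI, (integral_mono hI (i1.add i2) key).trans ?_⟩
  rw [integral_add' i1 i2, integral_const_mul, integral_const_mul]
  linarith [h1.2, h2.2]

lemma Ref.dw {lam a T C : ℝ} {ub ubx ubt b bx bt : ℝ → ℝ → ℝ}
    (h : Ref lam a T C ub ubx ubt b bx bt) {β : ℝ} (hβ0 : β ≠ 0) (hβ : |β| ≤ T / 4) {J : Set ℝ}
    (hJ : ∀ t ∈ J, t ∈ Set.Ico 0 T ∧ t + 2 * β ∈ Set.Ico 0 T) :
    L2 (tl β bt) J (9 * C / β ^ 2) := by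
  have l1 : L2 (fun x t => b (x + 0) (t + β) - b x t) J C := by
    intro t ht
    have hs := seg_mem (hJ t ht).1 (hJ t ht).2 (r := 1) (by norm_num)
    rw [mul_one] at hs
    have := h.d1' hs.1 (hJ t ht).1 (by
      rw [add_sub_cancel_left]; linarith [h.hT])
    simpa using this
  have l2 : L2 (fun x t => b (x + 0) (t + 2 * β) - b x t) J C := by
    intro t ht
    have := h.d1' (hJ t ht).2 (hJ t ht).1 (by
      rw [add_sub_cancel_left, abs_mul, abs_two]; linarith)
    simpa using this
  have c1 := (h.hb.c.sh 0 β).sub h.hb.c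
  have c2 := (h.hb.c.sh 0 (2 * β)).sub h.hb.c
  have l3 := (L2.sub (continuous_const.mul c1) (continuous_const.mul c2) (l1.smul 2)
    (l2.smul (1 / 2))).smul (1 / β)
  intro t ht
  have e : ∀ x, tl β bt x t = 1 / β * (2 * (b (x + 0) (t + β) - b x t)
      - 1 / 2 * (b (x + 0) (t + 2 * β) - b x t)) := by
    intro x
    have h1 := Av_ft h.hb.ct h.hb.ht β x t
    have h2 := Av_ft h.hb.ct h.hb.ht (2 * β) x t
    rw [add_zero, ← h1, ← h2]
    unfold tl
    field_simp
  have l4 := l3 t ht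
  simp only [e]
  refine ⟨l4.1, l4.2.trans ?_⟩
  have e3 : 9 * C / β ^ 2 = (1 / β) ^ 2 * (9 * C) := by ring
  rw [e3]
  refine mul_le_mul_of_nonneg_left ?_ (sq_nonneg _)
  linarith [h.hC]

lemma phase {ε lam a T C t0 t1 β M : ℝ} {ub ubx ubt b bx bt u ux ut v vx vt : ℝ → ℝ → ℝ}
    (h : Ref lam a T C ub ubx ubt b bx bt)
    (hsm : ε ^ 2 * a ^ 2 ≤ lam ^ 2 / 4) (hu : C1 u ux ut) (hv : C1 v vx vt)
    (e1 : ∀ x, ∀ t ∈ Set.Icc t0 t1, ut x t + vx x t = 0)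
    (e2 : ∀ x, ∀ t ∈ Set.Icc t0 t1, ε ^ 2 * vt x t + lam ^ 2 * ux x t = a * u x t - v x t)
    (lU : L2 (fun x t => u x t - ub x t) (Set.Icc t0 t1) M)
    (lV : L2 (fun x t => v x t - b x t) (Set.Icc t0 t1) M)
    (hβ0 : β ≠ 0) (hβ : |β| ≤ T / 4) (h01 : t0 ≤ t1)
    (hJ : ∀ t ∈ Set.Icc t0 t1, t ∈ Set.Ico 0 T ∧ t + 2 * β ∈ Set.Ico 0 T) :
    ∫ x, En ε lam a (u x t1 - ub x t1) (v x t1 - b x t1) ≤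
      64 * (∫ x, En ε lam a (u x t0 - ub x t0) (v x t0 - b x t0))
      + 18 * (lam ^ 2 * (|β| * C) + ε ^ 2 * (4 * C))
      + 8 * ((t1 - t0) * (ε ^ 4 * (9 * C / β ^ 2))) := by
  have ld := h.du hβ hJ
  have le := h.dv hβ hJ
  have lw := h.dw hβ0 hβ hJ
  have cu := (h.hu.tl β)
  have cb := (h.hb.tl β)
  have lU' : L2 (fun x t => u x t - tl β ub x t) (Set.Icc t0 t1) (2 * M + 2 * (|β| * C)) := by
    have := L2.add (hu.c.sub h.hu.c) (h.hu.c.sub cu.c) lU ld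
    simpa using this
  have lV' : L2 (fun x t => v x t - tl β b x t) (Set.Icc t0 t1) (2 * M + 2 * (4 * C)) := by
    have := L2.add (hv.c.sub h.hb.c) (h.hb.c.sub cb.c) lV le
    simpa using this
  have CU := hu.sub cu
  have CV := hv.sub cb
  have lf := (lw.smul (-ε ^ 2))
  have cf : Cn (fun x t => -ε ^ 2 * tl β bt x t) := continuous_const.mul cb.ct
  have sf := lf.strip h01 cf
  obtain ⟨iS, hS⟩ := entropy_l2 (ε := ε) (lam := lam) (a := a) (f := fun x t => -ε ^ 2 * tl β bt x t)
    (g := fun _ _ => 0) h01 CU CV cf continuous_const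
    (by
      intro x t ht
      have a1 := e1 x t ht
      have a2 := tl_eq (c := 1) (d := 1) (e := 0) (x := x) h.hu.ct h.hb.cx h.hb.cx (hJ t ht).1
        (hJ t ht).2 (fun x t ht => by linarith [h.e1 x t ht])
      linarith)
    (by
      intro x t ht
      have a1 := e2 x t ht
      have a2 := tl_eq (c := a) (d := -1) (e := lam ^ 2) (x := x) h.hu.c h.hb.c h.hu.cx (hJ t ht).1
        (hJ t ht).2 (fun x t ht => by linarith [h.e2 x t ht])
      linarith) lU' lV' sf.1 (by simp)
  have hSS : ∫ p, (-((v p.1 p.2 - tl β b p.1 p.2) - a * (u p.1 p.2 - tl β ub p.1 p.2)) ^ 2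
      + ((v p.1 p.2 - tl β b p.1 p.2) - a * (u p.1 p.2 - tl β ub p.1 p.2)) *
        (-ε ^ 2 * tl β bt p.1 p.2)
      + (lam ^ 2 * (u p.1 p.2 - tl β ub p.1 p.2) - ε ^ 2 * a * (v p.1 p.2 - tl β b p.1 p.2)) * 0)
        ∂(st t0 t1) ≤ (t1 - t0) * (ε ^ 4 * (9 * C / β ^ 2)) := by
    refine (integral_mono iS sf.1 fun p => ?_).trans (sf.2.trans (le_of_eq (by ring)))
    simp only
    set A := (v p.1 p.2 - tl β b p.1 p.2) - a * (u p.1 p.2 - tl β ub p.1 p.2)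
    set B := -ε ^ 2 * tl β bt p.1 p.2
    nlinarith [sq_nonneg (A - B), sq_nonneg (A), sq_nonneg B]
  have m0 : t0 ∈ Set.Icc t0 t1 := ⟨le_rfl, h01⟩
  have m1 : t1 ∈ Set.Icc t0 t1 := ⟨h01, le_rfl⟩
  have i : ∀ t ∈ Set.Icc t0 t1, Integrable (fun x => En ε lam a (u x t - ub x t) (v x t - b x t)) :=
    fun t ht => En_integrable ((hu.sub h.hu).c.slx t) ((hv.sub h.hb).c.slx t)
      (lU t ht).1 (lV t ht).1
  have i' : ∀ t ∈ Set.Icc t0 t1, Integrable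
      (fun x => En ε lam a (u x t - tl β ub x t) (v x t - tl β b x t)) :=
    fun t ht => En_integrable (CU.c.slx t) (CV.c.slx t) (lU' t ht).1 (lV' t ht).1
  have A : ∀ p q d e : ℝ, En ε lam a (p + d) (q + e) ≤ 8 * En ε lam a p q
      + 2 * lam ^ 2 * d ^ 2 + 2 * ε ^ 2 * e ^ 2 := by
    intro p q d e
    have h1 := En_upper hsm (p + d) (q + e)
    have h2 := En_lower hsm p q
    have h3 : 0 ≤ lam ^ 2 * (p - d) ^ 2 := by positivity
    have h4 : 0 ≤ ε ^ 2 * (q - e) ^ 2 := by positivity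
    linarith
  have k0 := int_le3 (i' t0 m0) (i t0 m0) (ld t0 m0).1 (le t0 m0).1 8 (2 * lam ^ 2) (2 * ε ^ 2)
    (fun x => by
      have := A (u x t0 - ub x t0) (v x t0 - b x t0) (ub x t0 - tl β ub x t0) (b x t0 - tl β b x t0)
      simpa using this)
  have k1 := int_le3 (i t1 m1) (i' t1 m1) (ld t1 m1).1 (le t1 m1).1 8 (2 * lam ^ 2) (2 * ε ^ 2)
    (fun x => by
      have := A (u x t1 - tl β ub x t1) (v x t1 - tl β b x t1) (-(ub x t1 - tl β ub x t1))
        (-(b x t1 - tl β b x t1))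
      rw [neg_sq, neg_sq] at this
      have e1 : u x t1 - tl β ub x t1 + -(ub x t1 - tl β ub x t1) = u x t1 - ub x t1 := by ring
      have e2 : v x t1 - tl β b x t1 + -(b x t1 - tl β b x t1) = v x t1 - b x t1 := by ring
      rw [e1, e2] at this
      exact this)
  have n1 := mul_le_mul_of_nonneg_left (ld t0 m0).2 (sq_nonneg lam)
  have n2 := mul_le_mul_of_nonneg_left (le t0 m0).2 (sq_nonneg ε)
  have n3 := mul_le_mul_of_nonneg_left (ld t1 m1).2 (sq_nonneg lam)
  have n4 := mul_le_mul_of_nonneg_left (le t1 m1).2 (sq_nonneg ε)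
  linarith

open MeasureTheory Filter Topology
set_option linter.unusedVariables false

noncomputable def px (f : ℝ → ℝ → ℝ) : ℝ → ℝ → ℝ := fun x t => deriv (fun y => f y t) x
noncomputable def pt (f : ℝ → ℝ → ℝ) : ℝ → ℝ → ℝ := fun x t => deriv (fun τ => f x τ) t

lemma hasDeriv_x {f : ℝ → ℝ → ℝ} (hf : Differentiable ℝ (fun p : ℝ × ℝ => f p.1 p.2)) (x t : ℝ) :
    HasDerivAt (fun y => f y t) (fderiv ℝ (fun p : ℝ × ℝ => f p.1 p.2) (x, t) (1, 0)) x :=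
  ((hf (x, t)).hasFDerivAt).comp_hasDerivAt (f := fun y : ℝ => (y, t)) x
    ((hasDerivAt_id x).prodMk (hasDerivAt_const x t))

lemma hasDeriv_t {f : ℝ → ℝ → ℝ} (hf : Differentiable ℝ (fun p : ℝ × ℝ => f p.1 p.2)) (x t : ℝ) :
    HasDerivAt (fun τ => f x τ) (fderiv ℝ (fun p : ℝ × ℝ => f p.1 p.2) (x, t) (0, 1)) t :=
  ((hf (x, t)).hasFDerivAt).comp_hasDerivAt (f := fun y : ℝ => (x, y)) t
    ((hasDerivAt_const t x).prodMk (hasDerivAt_id t))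

lemma C1_of {f : ℝ → ℝ → ℝ} (hf : ContDiff ℝ 1 (fun p : ℝ × ℝ => f p.1 p.2)) :
    C1 f (px f) (pt f) := by
  have hd := hf.differentiable one_ne_zero
  have hc := hf.continuous_fderiv one_ne_zero
  have ex : ∀ x t, px f x t = fderiv ℝ (fun p : ℝ × ℝ => f p.1 p.2) (x, t) (1, 0) :=
    fun x t => (hasDeriv_x hd x t).deriv
  have et : ∀ x t, pt f x t = fderiv ℝ (fun p : ℝ × ℝ => f p.1 p.2) (x, t) (0, 1) :=
    fun x t => (hasDeriv_t hd x t).deriv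
  refine ⟨hf.continuous, ?_, ?_, ?_, ?_⟩
  · simp only [Cn, ex]; exact hc.clm_apply continuous_const
  · simp only [Cn, et]; exact hc.clm_apply continuous_const
  · intro x t; rw [ex]; exact hasDeriv_x hd x t
  · intro x t; rw [et]; exact hasDeriv_t hd x t

abbrev Sm (f : ℝ → ℝ → ℝ) : Prop := ContDiff ℝ (⊤ : ℕ∞) (fun p : ℝ × ℝ => f p.1 p.2)

lemma Sm.c1 {f : ℝ → ℝ → ℝ} (hf : Sm f) : C1 f (px f) (pt f) :=
  C1_of (hf.of_le (by exact_mod_cast le_top))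

lemma Sm.px {f : ℝ → ℝ → ℝ} (hf : Sm f) : Sm (px f) := by
  have hd : Differentiable ℝ (fun p : ℝ × ℝ => f p.1 p.2) := hf.differentiable (by simp)
  have ex : (fun p : ℝ × ℝ => _root_.px f p.1 p.2)
      = fun p => fderiv ℝ (fun p : ℝ × ℝ => f p.1 p.2) p (1, 0) := by
    ext p; exact (hasDeriv_x hd p.1 p.2).deriv
  unfold Sm
  rw [ex]
  exact (hf.fderiv_right (m := ((⊤ : ℕ∞) : WithTop ℕ∞)) (by exact_mod_cast le_top)).clm_apply contDiff_const

lemma Sm.pt {f : ℝ → ℝ → ℝ} (hf : Sm f) : Sm (pt f) := by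
  have hd : Differentiable ℝ (fun p : ℝ × ℝ => f p.1 p.2) := hf.differentiable (by simp)
  have ex : (fun p : ℝ × ℝ => _root_.pt f p.1 p.2)
      = fun p => fderiv ℝ (fun p : ℝ × ℝ => f p.1 p.2) p (0, 1) := by
    ext p; exact (hasDeriv_t hd p.1 p.2).deriv
  unfold Sm
  rw [ex]
  exact (hf.fderiv_right (m := ((⊤ : ℕ∞) : WithTop ℕ∞)) (by exact_mod_cast le_top)).clm_apply contDiff_const

lemma mixed {f : ℝ → ℝ → ℝ} (hf : Sm f) (x t : ℝ) : pt (px f) x t = px (pt f) x t := by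
  have hd : Differentiable ℝ (fun p : ℝ × ℝ => f p.1 p.2) := hf.differentiable (by simp)
  have hF : ContDiff ℝ (⊤ : ℕ∞) (fderiv ℝ (fun p : ℝ × ℝ => f p.1 p.2)) :=
    hf.fderiv_right (m := ((⊤ : ℕ∞) : WithTop ℕ∞)) (by exact_mod_cast le_top)
  have hFd : Differentiable ℝ (fderiv ℝ (fun p : ℝ × ℝ => f p.1 p.2)) := hF.differentiable (by simp)
  have ex : (fun p : ℝ × ℝ => px f p.1 p.2)
      = fun p => fderiv ℝ (fun p : ℝ × ℝ => f p.1 p.2) p (1, 0) := by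
    ext p; exact (hasDeriv_x hd p.1 p.2).deriv
  have et : (fun p : ℝ × ℝ => pt f p.1 p.2)
      = fun p => fderiv ℝ (fun p : ℝ × ℝ => f p.1 p.2) p (0, 1) := by
    ext p; exact (hasDeriv_t hd p.1 p.2).deriv
  have h1 : pt (px f) x t = fderiv ℝ (fun p : ℝ × ℝ => px f p.1 p.2) (x, t) (0, 1) :=
    (hasDeriv_t (hf.px.differentiable (by simp)) x t).deriv
  have h2 : px (pt f) x t = fderiv ℝ (fun p : ℝ × ℝ => pt f p.1 p.2) (x, t) (1, 0) :=
    (hasDeriv_x (hf.pt.differentiable (by simp)) x t).deriv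
  have k : ∀ w : ℝ × ℝ, fderiv ℝ (fun p => fderiv ℝ (fun p : ℝ × ℝ => f p.1 p.2) p w) (x, t)
      = (fderiv ℝ (fderiv ℝ (fun p : ℝ × ℝ => f p.1 p.2)) (x, t)).flip w := by
    intro w
    have := ((hFd (x, t)).hasFDerivAt.clm_apply (hasFDerivAt_const w (x, t))).fderiv
    rw [this]; simp
  rw [h1, h2, ex, et, k, k]
  have sym : IsSymmSndFDerivAt ℝ (fun p : ℝ × ℝ => f p.1 p.2) (x, t) :=
    hf.contDiffAt.isSymmSndFDerivAt (by
      simp only [minSmoothness_of_isRCLikeNormedField]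
      exact WithTop.coe_le_coe.2 (le_top : (2 : ℕ∞) ≤ ⊤))
  exact sym (0, 1) (1, 0)

lemma st_eq (t0 t1 : ℝ) : st t0 t1 = (volume : Measure (ℝ × ℝ)).restrict
    (Set.univ ×ˢ Set.Ioc t0 t1) := by
  rw [Measure.volume_eq_prod, ← Measure.prod_restrict, Measure.restrict_univ]

lemma int_st {f : ℝ × ℝ → ℝ} {t : ℝ} (h : IntegrableOn f (Set.univ ×ˢ Set.Ico 0 t)) :
    Integrable f (st 0 t) := by
  unfold IntegrableOn at h
  rw [Measure.volume_eq_prod, ← Measure.prod_restrict, Measure.restrict_univ,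
    Measure.restrict_congr_set (Ico_ae_eq_Ioc (μ := volume))] at h
  exact h

lemma int_st_mono {f : ℝ × ℝ → ℝ} {t t' : ℝ} (h : t ≤ t') (hi : Integrable f (st 0 t')) :
    ∫ p, f p ∂(st 0 t) ≤ ∫ p, |f p| ∂(st 0 t') := by
  have hi' := hi.abs
  rw [st_eq 0 t'] at hi hi' ⊢
  rw [st_eq 0 t]
  have hsub : (Set.univ ×ˢ Set.Ioc 0 t : Set (ℝ × ℝ)) ⊆ Set.univ ×ˢ Set.Ioc 0 t' :=
    Set.prod_mono le_rfl (Set.Ioc_subset_Ioc_right h)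
  refine (integral_mono (IntegrableOn.mono_set hi hsub) (IntegrableOn.mono_set hi' hsub)
    fun p => le_abs_self _).trans ?_
  exact setIntegral_mono_set hi' (Eventually.of_forall fun p => abs_nonneg _)
    (LE.le.eventuallyLE hsub)

/-- qualitative square integrability of the error -/
lemma sys_of {ε lam a T' : ℝ} {U Ux Ut V Vx Vt b bx bt bxx : ℝ → ℝ → ℝ} (hε : 0 < ε)
    (hlam : 0 < lam) (hsm : ε ^ 2 * a ^ 2 ≤ lam ^ 2 / 4)
    (hU : C1 U Ux Ut) (hV : C1 V Vx Vt) (hb : C1 b bx bt) (cxx : Cn bxx)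
    (dxx : ∀ x t, HasDerivAt (fun y => bx y t) (bxx x t) x)
    (e1 : ∀ x, ∀ t ∈ Set.Icc 0 T', Ut x t + Vx x t = 0)
    (e2 : ∀ x, ∀ t ∈ Set.Icc 0 T',
      ε ^ 2 * Vt x t + lam ^ 2 * Ux x t = a * U x t - V x t - ε ^ 2 * bt x t)
    (e3 : ∀ x, ∀ t ∈ Set.Icc 0 T', bt x t + a * bx x t = lam ^ 2 * bxx x t)
    (hF : ∀ t ∈ Set.Icc 0 T', Integrable (fun p : ℝ × ℝ => Fn ε lam a (U p.1 p.2) (V p.1 p.2))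
      (st 0 t))
    (h3 : ∀ t ∈ Set.Icc 0 T', Integrable (fun p : ℝ × ℝ => (a * U p.1 p.2 - V p.1 p.2) ^ 2)
      (st 0 t))
    (h4 : ∀ t ∈ Set.Icc 0 T', Integrable (fun p : ℝ × ℝ =>
      (V p.1 p.2 - a * U p.1 p.2) * bt p.1 p.2) (st 0 t))
    (hE : ∀ t ∈ Set.Icc 0 T', Integrable (fun x => En ε lam a (U x t) (V x t))) :
    ∃ M, Sys ε lam a T' M U Ux Ut V Vx Vt b bx bt bxx := by
  set S : ℝ × ℝ → ℝ := fun p => -(V p.1 p.2 - a * U p.1 p.2) ^ 2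
      + (V p.1 p.2 - a * U p.1 p.2) * (-ε ^ 2 * bt p.1 p.2)
      + (lam ^ 2 * U p.1 p.2 - ε ^ 2 * a * V p.1 p.2) * 0 with hS
  have iS : ∀ t ∈ Set.Icc 0 T', Integrable S (st 0 t) := by
    intro t ht
    refine (((h3 t ht).const_mul (-1)).add ((h4 t ht).const_mul (-ε ^ 2))).congr
      (Eventually.of_forall fun p => ?_)
    simp only [hS, Pi.add_apply]; ring
  set B := (∫ x, En ε lam a (U x 0) (V x 0)) + ∫ p, |S p| ∂(st 0 T') with hB
  have key : ∀ t ∈ Set.Icc 0 T', ∫ x, En ε lam a (U x t) (V x t) ≤ B := by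
    intro t ht
    have h0 : (0:ℝ) ∈ Set.Icc 0 T' := ⟨le_rfl, ht.1.trans ht.2⟩
    have hT' : T' ∈ Set.Icc 0 T' := ⟨ht.1.trans ht.2, le_rfl⟩
    have := entropy_raw (ε := ε) (lam := lam) (a := a) (f := fun x t => -ε ^ 2 * bt x t)
      (g := fun _ _ => 0) ht.1 hU hV (fun x r hr => e1 x r ⟨hr.1, hr.2.trans ht.2⟩)
      (fun x r hr => by linarith [e2 x r ⟨hr.1, hr.2.trans ht.2⟩]) (hE 0 h0) (hE t ht)
      (hF t ht) (iS t ht)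
    rw [this, hB]
    have := int_st_mono ht.2 (iS T' hT')
    linarith
  refine ⟨max (4 * B / lam ^ 2) (4 * B / ε ^ 2), hU, hV, hb, cxx, dxx, e1, e2, e3, ?_, ?_⟩
  · refine L2.mono (M := 4 * B / lam ^ 2) ?_ le_rfl (le_max_left _ _)
    refine L2_of_le (g := fun x t => 4 / lam ^ 2 * En ε lam a (U x t) (V x t)) hU.c ?_ ?_
    · intro t ht
      refine ⟨(hE t ht).const_mul _, ?_⟩
      rw [integral_const_mul, mul_div_right_comm]
      exact mul_le_mul_of_nonneg_left (key t ht) (by positivity)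
    · intro x t _
      rw [div_mul_eq_mul_div, le_div_iff₀ (by positivity)]
      nlinarith [En_lower hsm (U x t) (V x t), mul_nonneg (sq_nonneg ε) (sq_nonneg (V x t))]
  · refine L2.mono (M := 4 * B / ε ^ 2) ?_ le_rfl (le_max_right _ _)
    refine L2_of_le (g := fun x t => 4 / ε ^ 2 * En ε lam a (U x t) (V x t)) hV.c ?_ ?_
    · intro t ht
      refine ⟨(hE t ht).const_mul _, ?_⟩
      rw [integral_const_mul, mul_div_right_comm]
      exact mul_le_mul_of_nonneg_left (key t ht) (by positivity)
    · intro x t _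
      rw [div_mul_eq_mul_div, le_div_iff₀ (by positivity)]
      nlinarith [En_lower hsm (U x t) (V x t), mul_nonneg (sq_nonneg lam) (sq_nonneg (U x t))]


/- STATEMENT 6: Continuous convergence: for a family (u^ε, v^ε) of strong solutions of
   the Jin–Xin system satisfying the hypotheses of the continuous stability theorem,
   with a fixed smooth limit solution (ū, v̄) satisfying the L² bound on ∂_t v̄,
   if φ^ε(0) → 0 as ε → 0 then sup_{t∈[0,T)} φ^ε(t) → 0 as ε → 0. -/
theorem jin_xin_continuous_convergence
    (T lam a K ε₀ : ℝ) (hT : 0 < T) (hlam : 0 < lam) (hK : 0 < K) (hε₀ : 0 < ε₀)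
    (u v : ℝ → ℝ → ℝ → ℝ) (ub vb : ℝ → ℝ → ℝ)
    (hub : ContDiff ℝ (⊤ : ℕ∞) (fun p : ℝ × ℝ => ub p.1 p.2))
    -- ū solves the convection–diffusion equation on ℝ × [0,T), v̄ = aū − λ²∂_xū
    (hlimit : ∀ x t : ℝ, 0 ≤ t → t < T →
      deriv (fun τ => ub x τ) t + a * deriv (fun y => ub y t) x
        = lam ^ 2 * deriv (fun y => deriv (fun z => ub z t) y) x)
    (hvb : ∀ x t : ℝ, vb x t = a * ub x t - lam ^ 2 * deriv (fun y => ub y t) x)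
    -- L² bound on ∂_t v̄
    (hvbK : (∫ s in Set.Ico (0:ℝ) T, ∫ x : ℝ, (deriv (fun τ => vb x τ) s) ^ 2) ≤ K)
    -- for each ε ∈ (0,ε₀), (u^ε,v^ε) is a strong solution of the Jin–Xin system
    (hu : ∀ e ∈ Set.Ioo (0:ℝ) ε₀, ContDiff ℝ 1 (fun p : ℝ × ℝ => u e p.1 p.2))
    (hv : ∀ e ∈ Set.Ioo (0:ℝ) ε₀, ContDiff ℝ 1 (fun p : ℝ × ℝ => v e p.1 p.2))
    (heq1 : ∀ e ∈ Set.Ioo (0:ℝ) ε₀, ∀ x t : ℝ, 0 ≤ t → t < T →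
      deriv (fun τ => u e x τ) t + deriv (fun y => v e y t) x = 0)
    (heq2 : ∀ e ∈ Set.Ioo (0:ℝ) ε₀, ∀ x t : ℝ, 0 ≤ t → t < T →
      e ^ 2 * deriv (fun τ => v e x τ) t + lam ^ 2 * deriv (fun y => u e y t) x
        = a * u e x t - v e x t)
    -- relative entropy flux vanishes at x = ±∞
    (hflux : ∀ e ∈ Set.Ioo (0:ℝ) ε₀, ∀ s : ℝ, 0 ≤ s → s < T →
      Tendsto (fun x => relEntropyFlux e lam a (u e) (v e) ub vb x s) atTop (nhds 0) ∧
      Tendsto (fun x => relEntropyFlux e lam a (u e) (v e) ub vb x s) atBot (nhds 0))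
    -- integrability of the relevant integrands
    (hint1 : ∀ e ∈ Set.Ioo (0:ℝ) ε₀, ∀ t : ℝ, 0 ≤ t → t < T →
      IntegrableOn (fun p : ℝ × ℝ => relEntropy e lam a (u e) (v e) ub vb p.1 p.2)
        (Set.univ ×ˢ Set.Ico 0 t))
    (hint2 : ∀ e ∈ Set.Ioo (0:ℝ) ε₀, ∀ t : ℝ, 0 ≤ t → t < T →
      IntegrableOn (fun p : ℝ × ℝ => relEntropyFlux e lam a (u e) (v e) ub vb p.1 p.2)
        (Set.univ ×ˢ Set.Ico 0 t))
    (hint3 : ∀ e ∈ Set.Ioo (0:ℝ) ε₀, ∀ t : ℝ, 0 ≤ t → t < T →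
      IntegrableOn (fun p : ℝ × ℝ =>
          (a * (u e p.1 p.2 - ub p.1 p.2) - (v e p.1 p.2 - vb p.1 p.2)) ^ 2)
        (Set.univ ×ˢ Set.Ico 0 t))
    (hint4 : ∀ e ∈ Set.Ioo (0:ℝ) ε₀, ∀ t : ℝ, 0 ≤ t → t < T →
      IntegrableOn (fun p : ℝ × ℝ =>
          ((v e p.1 p.2 - vb p.1 p.2) - a * (u e p.1 p.2 - ub p.1 p.2))
            * deriv (fun τ => vb p.1 τ) p.2)
        (Set.univ ×ˢ Set.Ico 0 t))
    (hint5 : ∀ e ∈ Set.Ioo (0:ℝ) ε₀, ∀ t : ℝ, 0 ≤ t → t < T →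
      Integrable (fun x => relEntropy e lam a (u e) (v e) ub vb x t))
    -- φ^ε(0) → 0 as ε → 0
    (hphi0 : Tendsto (fun e => ∫ x : ℝ, relEntropy e lam a (u e) (v e) ub vb x 0)
      (nhdsWithin 0 (Set.Ioo 0 ε₀)) (nhds 0)) :
    Tendsto
      (fun e => ⨆ t : Set.Ico (0:ℝ) T,
        ∫ x : ℝ, relEntropy e lam a (u e) (v e) ub vb x (t : ℝ))
      (nhdsWithin 0 (Set.Ioo 0 ε₀)) (nhds 0) := by
  have hvbe : vb = fun x t => a * ub x t - lam ^ 2 * px ub x t := by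
    funext x t; exact hvb x t
  have sub : Sm ub := hub
  have svb : Sm vb := by
    rw [hvbe]
    exact (contDiff_const.mul sub).sub (contDiff_const.mul sub.px)
  have cvb : C1 vb (px vb) (pt vb) := svb.c1
  have cub : C1 ub (px ub) (pt ub) := sub.c1
  have vbx : ∀ x t, px vb x t = a * px ub x t - lam ^ 2 * px (px ub) x t := by
    intro x t
    have := (((cub.hx x t).const_mul a).sub ((sub.px.c1.hx x t).const_mul (lam ^ 2))).deriv
    rw [← this, hvbe]; rfl
  have vbt : ∀ x t, pt vb x t = a * pt ub x t - lam ^ 2 * pt (px ub) x t := by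
    intro x t
    have := (((cub.ht x t).const_mul a).sub ((sub.px.c1.ht x t).const_mul (lam ^ 2))).deriv
    rw [← this, hvbe]; rfl
  have r1 : ∀ x, ∀ t ∈ Set.Ico 0 T, pt ub x t + px vb x t = 0 := by
    intro x t ht
    have h : pt ub x t + a * px ub x t = lam ^ 2 * px (px ub) x t := hlimit x t ht.1 ht.2
    rw [vbx]; linarith
  have r2 : ∀ x t, lam ^ 2 * px ub x t = a * ub x t - vb x t := by
    intro x t
    rw [hvbe]; ring
  have r3 : ∀ x, ∀ t ∈ Set.Ico 0 T, pt vb x t + a * px vb x t = lam ^ 2 * px (px vb) x t := by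
    intro x t ht
    have h1 : px (px vb) x t = - px (pt ub) x t := by
      have : (fun y => px vb y t) = fun y => -pt ub y t := by
        funext y; linarith [r1 y t ht]
      show deriv (fun y => px vb y t) x = _
      rw [this]
      exact (sub.pt.c1.hx x t).neg.deriv
    rw [h1, vbt, mixed sub]
    linear_combination a * r1 x t ht
  have small : ∀ e, 0 < e → e ≤ lam / (2 * (|a| + 1)) → e ^ 2 * a ^ 2 ≤ lam ^ 2 / 4 := by
    intro e he h
    have ha := abs_nonneg a
    rw [le_div_iff₀ (by positivity)] at h
    have h2 : e * |a| ≤ lam / 2 := by nlinarith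
    have h3 : (e * |a|) ^ 2 ≤ (lam / 2) ^ 2 := pow_le_pow_left₀ (by positivity) h2 2
    rw [mul_pow, sq_abs] at h3
    linarith
  have hsys : ∀ e ∈ Set.Ioo (0:ℝ) ε₀, e ≤ lam / (2 * (|a| + 1)) → ∀ T' < T,
      ∃ M, Sys e lam a T' M (fun x t => u e x t - ub x t) (fun x t => px (u e) x t - px ub x t)
        (fun x t => pt (u e) x t - pt ub x t) (fun x t => v e x t - vb x t)
        (fun x t => px (v e) x t - px vb x t) (fun x t => pt (v e) x t - pt vb x t)
        vb (px vb) (pt vb) (px (px vb)) := by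
    intro e he hs T' hT'
    have mem : ∀ t ∈ Set.Icc 0 T', t ∈ Set.Ico 0 T := fun t ht => ⟨ht.1, ht.2.trans_lt hT'⟩
    refine sys_of he.1 hlam (small e he.1 hs) ((C1_of (hu e he)).sub cub)
      ((C1_of (hv e he)).sub cvb) cvb svb.px.c1.cx (fun x t => svb.px.c1.hx x t)
      ?_ ?_ (fun x t ht => r3 x t (mem t ht)) ?_ ?_ ?_ ?_
    · intro x t ht
      have h1 : pt (u e) x t + px (v e) x t = 0 := heq1 e he x t ht.1 (mem t ht).2
      have h2 := r1 x t (mem t ht)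
      linarith
    · intro x t ht
      have h1 : e ^ 2 * pt (v e) x t + lam ^ 2 * px (u e) x t = a * u e x t - v e x t :=
        heq2 e he x t ht.1 (mem t ht).2
      have h2 := r2 x t
      linarith
    · intro t ht
      exact int_st (hint2 e he t ht.1 (mem t ht).2)
    · intro t ht
      exact int_st (hint3 e he t ht.1 (mem t ht).2)
    · intro t ht
      exact int_st (hint4 e he t ht.1 (mem t ht).2)
    · intro t ht
      exact hint5 e he t ht.1 (mem t ht).2
  have hl0 : 0 < lam / (2 * (|a| + 1)) := by positivity
  obtain ⟨C, hC, hd⟩ : ∃ C : ℝ, 0 ≤ C ∧ ∀ s t : ℝ, 0 ≤ s → s ≤ T / 2 → 0 ≤ t → t + s < T →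
      (Integrable (fun x => (vb x t - vb x (t + s)) ^ 2) ∧
        ∫ x, (vb x t - vb x (t + s)) ^ 2 ≤ C) ∧
      (Integrable (fun p : ℝ × ℝ => (px vb p.1 p.2 - px vb p.1 (p.2 + s)) ^ 2) (st 0 t) ∧
        ∫ p, (px vb p.1 p.2 - px vb p.1 (p.2 + s)) ^ 2 ∂(st 0 t) ≤ C) := by
    have h0 : 0 < min (ε₀ / 2) (lam / (2 * (|a| + 1))) := lt_min (by linarith) hl0
    have h1 : min (ε₀ / 2) (lam / (2 * (|a| + 1))) < ε₀ :=
      (min_le_left _ _).trans_lt (by linarith)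
    exact diff_bounds h0 hlam (small _ h0 (min_le_right _ _)) hT
      (hsys _ ⟨h0, h1⟩ (min_le_right _ _))
  have ref : Ref lam a T C ub (px ub) (pt ub) vb (px vb) (pt vb) :=
    ⟨hT, hC, cub, cvb, r1, fun x t _ => r2 x t, hd⟩
  set q : ℝ → ℝ := fun e => 18 * (lam ^ 2 * (e * C) + e ^ 2 * (4 * C)) + 8 * (T * (9 * C * e ^ 2))
    with hq
  set φ : ℝ → ℝ → ℝ := fun e t => ∫ x, relEntropy e lam a (u e) (v e) ub vb x t with hφ
  have main : ∀ e ∈ Set.Ioo (0:ℝ) ε₀, e ≤ lam / (2 * (|a| + 1)) → e ≤ T / 8 →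
      ∀ t ∈ Set.Ico 0 T, 0 ≤ φ e t ∧ φ e t ≤ 64 * (64 * φ e 0 + q e) + q e := by
    intro e he hs h8 t ht
    have hsm := small e he.1 hs
    have he0 := he.1
    have pos : ∀ t, 0 ≤ φ e t := fun t =>
      integral_nonneg fun x => En_nonneg hsm (u e x t - ub x t) (v e x t - vb x t)
    have q0 : 0 ≤ q e := by simp only [hq]; positivity
    have conv : ∀ d, d ≤ T → 18 * (lam ^ 2 * (e * C) + e ^ 2 * (4 * C))
        + 8 * (d * (e ^ 4 * (9 * C / e ^ 2))) ≤ q e := by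
      intro d hdT
      have : e ^ 4 * (9 * C / e ^ 2) = 9 * C * e ^ 2 := by field_simp
      rw [this]
      have : d * (9 * C * e ^ 2) ≤ T * (9 * C * e ^ 2) :=
        mul_le_mul_of_nonneg_right hdT (by positivity)
      simp only [hq]; linarith
    have step : ∀ t0 t1 β : ℝ, 0 ≤ t0 → t0 ≤ t1 → t1 < T → |β| = e →
        (∀ t ∈ Set.Icc t0 t1, t + 2 * β ∈ Set.Ico 0 T) → φ e t1 ≤ 64 * φ e t0 + q e := by
      intro t0 t1 β h0 h01 h1 hβ hJ
      obtain ⟨M, hM⟩ := hsys e he hs t1 h1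
      have hI : ∀ t ∈ Set.Icc t0 t1, t ∈ Set.Icc 0 t1 := fun t ht => ⟨h0.trans ht.1, ht.2⟩
      have hβ0 : β ≠ 0 := by
        intro h; rw [h, abs_zero] at hβ; linarith
      have := phase (t0 := t0) (t1 := t1) (β := β) (M := M) ref hsm (C1_of (hu e he))
        (C1_of (hv e he))
        (fun x t ht => heq1 e he x t (hI t ht).1 ((hI t ht).2.trans_lt h1))
        (fun x t ht => heq2 e he x t (hI t ht).1 ((hI t ht).2.trans_lt h1))
        (fun t ht => hM.lU t (hI t ht)) (fun t ht => hM.lV t (hI t ht)) hβ0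
        (by rw [hβ]; linarith) h01
        (fun t ht => ⟨⟨(hI t ht).1, (hI t ht).2.trans_lt h1⟩, hJ t ht⟩)
      rw [← sq_abs β, hβ] at this
      have h2 : φ e t1 ≤ 64 * φ e t0 + 18 * (lam ^ 2 * (e * C) + e ^ 2 * (4 * C))
        + 8 * ((t1 - t0) * (e ^ 4 * (9 * C / e ^ 2))) := this
      linarith [conv (t1 - t0) (by linarith)]
    refine ⟨pos t, ?_⟩
    have p1 : ∀ t, 0 ≤ t → t ≤ T / 2 → φ e t ≤ 64 * φ e 0 + q e := by
      intro t h0 h1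
      refine step 0 t e le_rfl h0 (by linarith) (abs_of_pos he0) ?_
      intro r hr
      exact ⟨by linarith [hr.1], by linarith [hr.2]⟩
    rcases le_total t (T / 2) with h | h
    · have := p1 t ht.1 h
      linarith [pos 0]
    · have h1 := p1 (T / 2) (by linarith) le_rfl
      have h2 := step (T / 2) t (-e) (by linarith) h ht.2 (by rw [abs_neg, abs_of_pos he0])
        (by
          intro r hr
          exact ⟨by linarith [hr.1], by linarith [hr.2, ht.2]⟩)
      linarith
  have hne : Nonempty (Set.Ico (0:ℝ) T) := ⟨⟨0, le_rfl, hT⟩⟩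
  have ev : ∀ᶠ e in nhdsWithin 0 (Set.Ioo 0 ε₀), e ∈ Set.Ioo (0:ℝ) ε₀ ∧
      e ≤ lam / (2 * (|a| + 1)) ∧ e ≤ T / 8 := by
    have h1 : ∀ᶠ e in nhds (0:ℝ), e ≤ lam / (2 * (|a| + 1)) := eventually_le_nhds hl0
    have h2 : ∀ᶠ e in nhds (0:ℝ), e ≤ T / 8 := eventually_le_nhds (by linarith)
    filter_upwards [self_mem_nhdsWithin, h1.filter_mono nhdsWithin_le_nhds,
      h2.filter_mono nhdsWithin_le_nhds] with e a1 a2 a3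
    exact ⟨a1, a2, a3⟩
  have hqt : Tendsto q (nhdsWithin 0 (Set.Ioo 0 ε₀)) (nhds 0) := by
    have hc : Continuous q := by simp only [hq]; fun_prop
    have := hc.tendsto 0
    have h0 : q 0 = 0 := by simp [hq]
    rw [h0] at this
    exact this.mono_left nhdsWithin_le_nhds
  have hbt : Tendsto (fun e => 64 * (64 * φ e 0 + q e) + q e)
      (nhdsWithin 0 (Set.Ioo 0 ε₀)) (nhds 0) := by
    have := (((hphi0.const_mul 64).add hqt).const_mul 64).add hqt
    simpa using this
  refine squeeze_zero' ?_ ?_ hbt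
  · filter_upwards [ev] with e he
    exact Real.iSup_nonneg fun t => (main e he.1 he.2.1 he.2.2 t t.2).1
  · filter_upwards [ev] with e he
    exact ciSup_le fun t => (main e he.1 he.2.1 he.2.2 t t.2).2
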